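/- Let G be a Feynman graph with three external vertices labelled 0, 1, z which is ultraviolet convergent and infrared convergent. Then the graphical function f_G is real analytic on ℂ∖{0,1}; that is, the function (a,b) ↦ f_G(a + b·i) is a real-analytic (finite real-valued) function on ℝ² ∖ {(0,0),(1,0)}. -/

import Mathlib

open scoped Classical ENNReal
open MeasureTheory

noncomputable section

/-- A Feynman graph with vertices `Fin nV`, edges `Fin nE` (each edge has two
distinct endpoints, multiple edges allowed), a set of external vertices and
real edge weights. -/
structure FeynmanGraph (nV nE : ℕ) where
  ends : Fin nE → Fin nV × Fin nV
  ends_ne : ∀ e, (ends e).1 ≠ (ends e).2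
  ext : Finset (Fin nV)
  ν : Fin nE → ℝ

/-- `λ = d/2 - 1`. -/
def lam (d : ℕ) : ℝ := (d : ℝ) / 2 - 1

namespace FeynmanGraph

variable {nV nE : ℕ} (G : FeynmanGraph nV nE)

/-- The edge `e` is incident to the vertex `v`. -/
def Incident (e : Fin nE) (v : Fin nV) : Prop :=
  (G.ends e).1 = v ∨ (G.ends e).2 = v

/-- The edge `e` joins the vertices `u` and `v`. -/
def Joins (e : Fin nE) (u v : Fin nV) : Prop :=
  G.ends e = (u, v) ∨ G.ends e = (v, u)

/-- The internal vertices of `G`. -/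
def intVerts : Finset (Fin nV) := Finset.univ.filter (fun v => v ∉ G.ext)

/-- The simple graph on the vertices of `G` induced by a subset `F` of the edges. -/
def edgeGraph (F : Finset (Fin nE)) : SimpleGraph (Fin nV) :=
  SimpleGraph.fromRel (fun u v => ∃ e ∈ F, G.Joins e u v)

/-- `F` is a spanning forest of `G` compatible with the collection `p` of pairwise
disjoint vertex sets: `F` is acyclic (as a set of multigraph edges), the graph
`(V, F)` has exactly `p.card` connected components, and distinct parts of `p` lie in
distinct components.  (Acyclicity together with the component count is expressed by
the edge count `F.card + p.card = nV`.) -/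
def IsForest (p : Finset (Finset (Fin nV))) (F : Finset (Fin nE)) : Prop :=
  F.card + p.card = nV ∧
  Nat.card (G.edgeGraph F).ConnectedComponent = p.card ∧
  (∀ P ∈ p, ∀ u ∈ P, ∀ v ∈ P, (G.edgeGraph F).Reachable u v) ∧
  (∀ P ∈ p, ∀ Q ∈ p, P ≠ Q → ∀ u ∈ P, ∀ v ∈ Q, ¬ (G.edgeGraph F).Reachable u v)

/-- The set `𝓕_G^p` of spanning forests compatible with `p`. -/
def forests (p : Finset (Finset (Fin nV))) : Finset (Finset (Fin nE)) :=
  Finset.univ.filter (fun F => G.IsForest p F)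

/-- The dual spanning forest polynomial `Ψ̃_G^p`, evaluated at `α`. -/
def dualForestPoly (p : Finset (Finset (Fin nV))) (α : Fin nE → ℝ) : ℝ :=
  ∑ F ∈ G.forests p, ∏ e ∈ F, α e

/-- The spanning forest polynomial `Ψ_G^p`, evaluated at `α`. -/
def forestPoly (p : Finset (Finset (Fin nV))) (α : Fin nE → ℝ) : ℝ :=
  ∑ F ∈ G.forests p, ∏ e ∈ Finset.univ \ F, α e

/-- The partition of the external vertices into singletons. -/
def singlePart : Finset (Finset (Fin nV)) := G.ext.image (fun v => {v})

/-- The collection `p(i,j)` consisting of `{i, j}` together with the singletons of the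
remaining external vertices. -/
def pairPart (i j : Fin nV) : Finset (Finset (Fin nV)) :=
  insert ({i, j} : Finset (Fin nV)) (((G.ext.erase i).erase j).image (fun v => {v}))

/-- `Ψ̃_G`, evaluated at `α`. -/
def psiTilde (α : Fin nE → ℝ) : ℝ := G.dualForestPoly G.singlePart α

/-- `Φ̃_G(α, x) = Σ_{i<j external} ‖x_i - x_j‖² Ψ̃_G^{p(i,j)}(α)`. -/
def phiTilde {d : ℕ} (x : Fin nV → EuclideanSpace ℝ (Fin d)) (α : Fin nE → ℝ) : ℝ :=
  ∑ i ∈ G.ext, ∑ j ∈ G.ext.filter (fun j => i < j),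
    ‖x i - x j‖ ^ 2 * G.dualForestPoly (G.pairPart i j) α

/-- Positions of all vertices: external vertices are placed according to `x`,
internal vertices according to `y`. -/
def assemble {E : Type*} (x : Fin nV → E) (y : {v : Fin nV // v ∉ G.ext} → E) :
    Fin nV → E :=
  fun v => if h : v ∉ G.ext then y ⟨v, h⟩ else x v

/-- The position space Feynman integral
`f_G(x) = ∫ ∏_{v internal} d^d x_v/π^{d/2} ∏_e ‖x_{u(e)} - x_{w(e)}‖^{-2λν_e}`,
a Lebesgue integral of a nonnegative function, with values in `[0,∞]`.  Only the
external components of `x` matter. -/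
def posIntegral (d : ℕ) (x : Fin nV → EuclideanSpace ℝ (Fin d)) : ℝ≥0∞ :=
  (∫⁻ y : {v : Fin nV // v ∉ G.ext} → EuclideanSpace ℝ (Fin d),
      ENNReal.ofReal (∏ e,
        ‖G.assemble x y (G.ends e).1 - G.assemble x y (G.ends e).2‖ ^ (-(2 * lam d * G.ν e)))) /
    ENNReal.ofReal (Real.pi ^ ((d : ℝ) / 2 * (G.intVerts.card : ℝ)))

/-- The standard positions of the three external vertices `0`, `1`, `z`. -/
def extPos (d : ℕ) (v0 v1 vz : Fin nV) (z : ℂ) : Fin nV → EuclideanSpace ℝ (Fin d) :=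
  fun v =>
    if v = v0 then 0
    else if v = v1 then WithLp.toLp 2 (fun i : Fin d => if (i : ℕ) = 0 then 1 else 0)
    else if v = vz then
      WithLp.toLp 2 (fun i : Fin d => if (i : ℕ) = 0 then z.re else if (i : ℕ) = 1 then z.im else 0)
    else 0

/-- The graphical function `f_G(z)` of a graph with the three external vertices
`v0`, `v1`, `vz`. -/
def graphicalFn (d : ℕ) (v0 v1 vz : Fin nV) (z : ℂ) : ℝ≥0∞ :=
  G.posIntegral d (extPos d v0 v1 vz z)

/-- The edges of `G` having both endpoints in `Vg`. -/
def edgesWithin (Vg : Finset (Fin nV)) : Finset (Fin nE) :=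
  Finset.univ.filter (fun e => (G.ends e).1 ∈ Vg ∧ (G.ends e).2 ∈ Vg)

/-- Ultraviolet convergence. -/
def UVConvergent (d : ℕ) : Prop :=
  ∀ Vg : Finset (Fin nV), 2 ≤ Vg.card → (Vg ∩ G.ext).card ≤ 1 →
    lam d * ∑ e ∈ G.edgesWithin Vg, G.ν e < (d : ℝ) / 2 * ((Vg.card : ℝ) - 1)

/-- `(Vg, Eg)` is a subgraph of `G`. -/
def IsSubgraph (Vg : Finset (Fin nV)) (Eg : Finset (Fin nE)) : Prop :=
  ∀ e ∈ Eg, (G.ends e).1 ∈ Vg ∧ (G.ends e).2 ∈ Vg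

/-- `v` is a `g`-internal vertex of the subgraph `g = (Vg, Eg)`. -/
def GInternal (Vg : Finset (Fin nV)) (Eg : Finset (Fin nE)) (v : Fin nV) : Prop :=
  v ∉ G.ext ∧ v ∈ Vg ∧ ∀ e, G.Incident e v → e ∈ Eg

/-- The set of `g`-internal vertices of the subgraph `g = (Vg, Eg)`. -/
def gInternalSet (Vg : Finset (Fin nV)) (Eg : Finset (Fin nE)) : Finset (Fin nV) :=
  Finset.univ.filter (fun v => G.GInternal Vg Eg v)

/-- Infrared convergence. -/
def IRConvergent (d : ℕ) : Prop :=
  ∀ Vg : Finset (Fin nV), ∀ Eg : Finset (Fin nE), G.IsSubgraph Vg Eg →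
    0 < (G.gInternalSet Vg Eg).card →
    (∀ e ∈ Eg, G.GInternal Vg Eg (G.ends e).1 ∨ G.GInternal Vg Eg (G.ends e).2) →
    (d : ℝ) / 2 * ((G.gInternalSet Vg Eg).card : ℝ) < lam d * ∑ e ∈ Eg, G.ν e

/-- The superficial degree of divergence `M_G = λ ν_G - (d/2)·V_int`. -/
def Mdeg (d : ℕ) : ℝ := lam d * ∑ e, G.ν e - (d : ℝ) / 2 * (G.intVerts.card : ℝ)

end FeynmanGraph

/-- A greedy (Prim) ordering of a finite vertex set with lengths `δ`, starting from the set `A`: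
the vertices outside `A` are added one by one, each being joined to a `parent` added earlier by a
shortest connection between the vertices already reached and the remaining ones. -/
structure PrimOrder {V : Type*} [Fintype V] [DecidableEq V] (δ : V → V → ℝ) (A : Finset V) where
  idx : V → ℕ
  parent : V → V
  idx_eq_zero : ∀ v, idx v = 0 ↔ v ∈ A
  idx_inj : ∀ u v, v ∉ A → idx u = idx v → u = v
  idx_le : ∀ v, idx v ≤ Aᶜ.card
  idx_parent_lt : ∀ v, v ∉ A → idx (parent v) < idx v
  parent_le : ∀ v, v ∉ A → ∀ u w, idx u < idx v → idx v ≤ idx w → δ v (parent v) ≤ δ w u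

namespace PrimOrder

variable {V : Type*} [Fintype V] [DecidableEq V] {δ : V → V → ℝ} {A : Finset V}

theorem exists_primOrder (δ : V → V → ℝ) (A : Finset V) (hA : A.Nonempty) :
    Nonempty (PrimOrder δ A) := by
  induction hn : Aᶜ.card generalizing A with
  | zero =>
    have hA' : ∀ v, v ∈ A := by
      intro v
      have := Finset.card_eq_zero.1 hn
      by_contra hv
      have : v ∈ Aᶜ := by simpa using hv
      simp_all
    exact ⟨⟨fun _ => 0, id, by simp [hA'], fun _ v hv => absurd (hA' v) hv, by simp,
      fun v hv => absurd (hA' v) hv, fun v hv => absurd (hA' v) hv⟩⟩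
  | succ n ih =>
    have hne : (Aᶜ ×ˢ A).Nonempty :=
      Finset.Nonempty.product (Finset.card_pos.1 (by omega)) hA
    obtain ⟨⟨v, u⟩, hvu, hmin⟩ := Finset.exists_min_image (Aᶜ ×ˢ A) (fun q => δ q.1 q.2) hne
    simp only [Finset.mem_product, Finset.mem_compl, Prod.forall] at hvu hmin
    obtain ⟨hv, hu⟩ := hvu
    have hcard : (insert v A)ᶜ.card = n := by
      rw [Finset.compl_insert, Finset.card_erase_of_mem (by simpa using hv)]
      omega
    obtain ⟨P⟩ := ih (insert v A) (by simp) hcard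
    have hz : ∀ w, w ∈ A → P.idx w = 0 := fun w hw => (P.idx_eq_zero w).2 (by simp [hw])
    have hzv : P.idx v = 0 := (P.idx_eq_zero v).2 (by simp)
    have hpos : ∀ w, w ∉ A → w ≠ v → 0 < P.idx w := by
      intro w hw hwv
      refine Nat.pos_of_ne_zero fun h => ?_
      have := (P.idx_eq_zero w).1 h
      simp_all
    refine ⟨⟨fun w => if w ∈ A then 0 else P.idx w + 1,
      fun w => if w = v then u else P.parent w, ?_, ?_, ?_, ?_, ?_⟩⟩
    · intro w
      by_cases hw : w ∈ A <;> simp [hw]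
    · intro w w' hw' h
      by_cases hw : w ∈ A
      · simp [hw, hw'] at h
      · simp only [hw, hw', if_false] at h
        by_cases h1 : w' = v
        · subst h1
          by_contra h2
          have := hpos w hw h2
          omega
        · exact P.idx_inj w w' (by simp [h1, hw']) (by omega)
    · intro w
      have := P.idx_le w
      by_cases hw : w ∈ A
      · simp [hw]
      · simp only [hw, if_false]
        omega
    · intro w hw
      by_cases h1 : w = v
      · simp [h1, hu, hv]
      · have := P.idx_parent_lt w (by simp [h1, hw])
        simp only [h1, hw, if_false]
        split_ifs <;> omega
    · intro w hw x y hx hy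
      have hy' : y ∉ A := by
        intro h
        simp [hw, h] at hy
      by_cases h1 : w = v
      · subst h1
        have hx' : x ∈ A := by
          by_contra h
          simp [hw, h, hzv] at hx
        simpa using hmin y x ⟨hy', hx'⟩
      · simp only [h1, hw, hy', if_false] at hx hy ⊢
        refine P.parent_le w (by simp [h1, hw]) x y ?_ (by omega)
        by_cases hx' : x ∈ A
        · rw [hz x hx']
          exact hpos w hw h1
        · simp only [hx', if_false] at hx
          omega

variable (P : PrimOrder δ A)

/-- The length of the connection of `v` to its parent. -/
def len (v : V) : ℝ := δ v (P.parent v)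

/-- The root of `v` in the forest of all connections of length at most `s`. -/
def root (s : ℝ) (v : V) : V :=
  if _h : v ∈ A ∨ s < P.len v then v else root s (P.parent v)
termination_by P.idx v
decreasing_by exact P.idx_parent_lt v (fun hv => _h (Or.inl hv))

theorem root_of_mem {s : ℝ} {v : V} (h : v ∈ A ∨ s < P.len v) : P.root s v = v := by
  rw [root, dif_pos h]

theorem root_of_le {s : ℝ} {v : V} (hv : v ∉ A) (h : P.len v ≤ s) :
    P.root s v = P.root s (P.parent v) := by
  rw [root, dif_neg (by simp [hv, h])]

/-- Induction along the parents. -/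
theorem parent_induction {p : V → Prop} (s : ℝ) (hroot : ∀ v, v ∈ A ∨ s < P.len v → p v)
    (hstep : ∀ v, v ∉ A → P.len v ≤ s → p (P.parent v) → p v) (v : V) : p v := by
  induction hn : P.idx v using Nat.strong_induction_on generalizing v with
  | _ n ih =>
    by_cases h : v ∈ A ∨ s < P.len v
    · exact hroot v h
    · push Not at h
      exact hstep v h.1 h.2 (ih _ (hn ▸ P.idx_parent_lt v h.1) _ rfl)

theorem root_mem (s : ℝ) (v : V) : P.root s v ∈ A ∨ s < P.len (P.root s v) := by
  refine P.parent_induction (p := fun v => P.root s v ∈ A ∨ s < P.len (P.root s v)) s ?_ ?_ v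
  · intro v h
    rwa [P.root_of_mem h]
  · intro v hv h ih
    rwa [P.root_of_le hv h]

theorem root_root {s s' : ℝ} (hs : s ≤ s') (v : V) : P.root s' (P.root s v) = P.root s' v := by
  refine P.parent_induction (p := fun v => P.root s' (P.root s v) = P.root s' v) s ?_ ?_ v
  · intro v h
    rw [P.root_of_mem h]
  · intro v hv h ih
    rw [P.root_of_le hv h, ih, P.root_of_le hv (h.trans hs)]

theorem root_eq_self_iff {s : ℝ} {v : V} : P.root s v = v ↔ v ∈ A ∨ s < P.len v := by
  refine ⟨fun h => ?_, P.root_of_mem⟩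
  have := P.root_mem s v
  rwa [h] at this

theorem root_mem_of_le {s s' : ℝ} (hs : s ≤ s') {v : V} (h : P.root s v ∈ A) :
    P.root s' v = P.root s v := by
  rw [← P.root_root hs, P.root_of_mem (Or.inl h)]

theorem idx_root_le (s : ℝ) (v : V) : P.idx (P.root s v) ≤ P.idx v := by
  refine P.parent_induction (p := fun v => P.idx (P.root s v) ≤ P.idx v) s ?_ ?_ v
  · intro v h
    rw [P.root_of_mem h]
  · intro v hv h ih
    rw [P.root_of_le hv h]
    exact ih.trans (P.idx_parent_lt v hv).le

/-- The vertices added after a root outside `A` have roots added after it. -/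
theorem le_idx_root {s : ℝ} {r : V} (hr : r ∉ A) (hs : s < P.len r) {v : V}
    (hv : P.idx r ≤ P.idx v) : P.idx r ≤ P.idx (P.root s v) := by
  revert hv
  refine P.parent_induction (p := fun v => P.idx r ≤ P.idx v → P.idx r ≤ P.idx (P.root s v))
    s ?_ ?_ v
  · intro v h hv
    rwa [P.root_of_mem h]
  · intro v hv h ih hrv
    rw [P.root_of_le hv h]
    refine ih (not_lt.1 fun hlt => ?_)
    exact absurd ((P.parent_le r hr _ v hlt hrv).trans h) (not_le.2 hs)

theorem lt_of_idx_root_lt (hsymm : ∀ u v, δ u v = δ v u) {s : ℝ} {u w : V}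
    (h : P.idx (P.root s u) < P.idx (P.root s w)) : s < δ u w := by
  have hr : P.root s w ∉ A := fun hA => by
    rw [(P.idx_eq_zero _).2 hA] at h
    omega
  have hs : s < P.len (P.root s w) := (P.root_mem s w).resolve_left hr
  have hu : P.idx u < P.idx (P.root s w) := by
    by_contra hu
    have := P.le_idx_root hr hs (not_lt.1 hu)
    omega
  rw [hsymm]
  exact hs.trans_le (P.parent_le _ hr _ _ hu (P.idx_root_le s w))

/-- Vertices with different roots, not both in `A`, are far apart. -/
theorem lt_of_root_ne (hsymm : ∀ u v, δ u v = δ v u) {s : ℝ} {u w : V}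
    (h : P.root s u ≠ P.root s w) (hA : ¬(P.root s u ∈ A ∧ P.root s w ∈ A)) : s < δ u w := by
  rcases lt_trichotomy (P.idx (P.root s u)) (P.idx (P.root s w)) with h' | h' | h'
  · exact P.lt_of_idx_root_lt hsymm h'
  · by_cases hw : P.root s w ∈ A
    · exact absurd (P.idx_inj _ _ (fun hu => hA ⟨hu, hw⟩) h'.symm).symm h
    · exact absurd (P.idx_inj _ _ hw h') h
  · rw [hsymm]
    exact P.lt_of_idx_root_lt hsymm h'

/-- Every vertex is close to its root. -/
theorem dist_root_le (hself : ∀ v, δ v v = 0) (htri : ∀ u v w, δ u w ≤ δ u v + δ v w) {s : ℝ}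
    (hs : 0 ≤ s) (v : V) : δ v (P.root s v) ≤ Aᶜ.card * s := by
  have key : δ v (P.root s v) ≤ P.idx v * s := by
    refine P.parent_induction (p := fun v => δ v (P.root s v) ≤ P.idx v * s) s ?_ ?_ v
    · intro v h
      rw [P.root_of_mem h, hself]
      positivity
    · intro v hv h ih
      rw [P.root_of_le hv h]
      have h1 : ((P.idx (P.parent v) : ℝ) + 1) ≤ P.idx v := by
        exact_mod_cast P.idx_parent_lt v hv
      have h2 := htri v (P.parent v) (P.root s (P.parent v))
      have h3 : δ v (P.parent v) ≤ s := h
      nlinarith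
  refine key.trans ?_
  have : (P.idx v : ℝ) ≤ Aᶜ.card := by exact_mod_cast P.idx_le v
  gcongr

end PrimOrder

/-- An integer as an alternating count of the levels below and above it. -/
theorem Int.cast_eq_sum_levels {m : ℤ} {M : ℕ} (hm : |m| ≤ M) :
    (m : ℝ) = ∑ k ∈ Finset.Ico (0 : ℤ) M, (if k < m then (1 : ℝ) else 0) -
      ∑ k ∈ Finset.Ico (-M : ℤ) 0, (if m ≤ k then (1 : ℝ) else 0) := by
  have h1 : (Finset.Ico (0 : ℤ) M).filter (fun k => k < m) = Finset.Ico 0 m := by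
    ext k
    simp only [Finset.mem_filter, Finset.mem_Ico]
    have := abs_le.1 hm
    omega
  have h2 : (Finset.Ico (-M : ℤ) 0).filter (fun k => m ≤ k) = Finset.Ico m 0 := by
    ext k
    simp only [Finset.mem_filter, Finset.mem_Ico]
    have := abs_le.1 hm
    omega
  rw [← Finset.sum_filter, ← Finset.sum_filter, h1, h2]
  simp only [Finset.sum_const, Int.card_Ico, nsmul_eq_mul, mul_one]
  have h3 : m = ((m - 0).toNat : ℤ) - ((0 - m).toNat : ℤ) := by omega
  exact_mod_cast h3

/-- If all partial sums of `c` over lower levels below zero are nonpositive and all those over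
upper levels above zero are nonnegative, then `∑ c i * m i` is nonnegative. -/
theorem sum_mul_level_nonneg {ι : Type*} [Fintype ι] (c : ι → ℝ) (m : ι → ℤ)
    (hneg : ∀ k < 0, ∑ i, (if m i ≤ k then c i else 0) ≤ 0)
    (hpos : ∀ k, 0 ≤ k → 0 ≤ ∑ i, (if k < m i then c i else 0)) :
    0 ≤ ∑ i, c i * m i := by
  obtain ⟨M, hM⟩ : ∃ M : ℕ, ∀ i, |m i| ≤ M := by
    refine ⟨∑ i, (m i).natAbs, fun i => ?_⟩
    have := Finset.single_le_sum (f := fun i => (m i).natAbs) (fun _ _ => Nat.zero_le _)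
      (Finset.mem_univ i)
    have h : ((m i).natAbs : ℤ) ≤ ((∑ i, (m i).natAbs : ℕ) : ℤ) := by exact_mod_cast this
    rwa [Int.natCast_natAbs] at h
  have h1 : ∀ i, c i * m i = ∑ k ∈ Finset.Ico (0 : ℤ) M, (if k < m i then c i else 0) -
      ∑ k ∈ Finset.Ico (-M : ℤ) 0, (if m i ≤ k then c i else 0) := by
    intro i
    rw [Int.cast_eq_sum_levels (hM i), mul_sub, Finset.mul_sum, Finset.mul_sum]
    simp
  simp_rw [h1]
  rw [Finset.sum_sub_distrib, Finset.sum_comm,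
    Finset.sum_comm (s := Finset.univ) (t := Finset.Ico (-M : ℤ) 0)]
  have h2 : 0 ≤ ∑ k ∈ Finset.Ico (0 : ℤ) M, ∑ i, (if k < m i then c i else 0) :=
    Finset.sum_nonneg fun k hk => hpos k (Finset.mem_Ico.1 hk).1
  have h3 : ∑ k ∈ Finset.Ico (-M : ℤ) 0, ∑ i, (if m i ≤ k then c i else 0) ≤ 0 :=
    Finset.sum_nonpos fun k hk => hneg k (Finset.mem_Ico.1 hk).2
  linarith

/-- The weighted form of `sum_mul_level_nonneg` comparing two families of levels. -/
theorem sum_level_le_sum_level {ε V : Type*} [Fintype ε] (a : ε → ℝ) (m : ε → ℤ)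
    (T : Finset V) (n : V → ℤ) (D η : ℝ)
    (hneg : ∀ k < 0, ∑ e, (if m e ≤ k then a e else 0) ≤
      (D - η) * (T.filter fun v => n v ≤ k).card)
    (hpos : ∀ k, 0 ≤ k → (D + η) * (T.filter fun v => k < n v).card ≤
      ∑ e, (if k < m e then a e else 0)) :
    ∑ v ∈ T, (D * n v + η * |(n v : ℝ)|) ≤ ∑ e, a e * m e := by
  have key := sum_mul_level_nonneg (ι := ε ⊕ T)
    (Sum.elim a fun v => if 0 < n v then -(D + η) else -(D - η))
    (Sum.elim m fun v => n v) ?_ ?_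
  · rw [Fintype.sum_sum_type] at key
    simp only [Sum.elim_inl, Sum.elim_inr] at key
    have h : ∀ v : T, (if 0 < n v then -(D + η) else -(D - η)) * (n v : ℝ) =
        -(D * n v + η * |(n v : ℝ)|) := by
      intro v
      split_ifs with hv
      · rw [abs_of_pos (by exact_mod_cast hv)]
        ring
      · rw [abs_of_nonpos (by exact_mod_cast not_lt.1 hv)]
        ring
    simp_rw [h] at key
    rw [Finset.sum_neg_distrib,
      Finset.sum_coe_sort T (fun v => D * (n v : ℝ) + η * |(n v : ℝ)|)] at key
    linarith
  · intro k hk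
    rw [Fintype.sum_sum_type]
    change ∑ e, (if m e ≤ k then a e else 0) +
      ∑ v : T, (if n v ≤ k then (if 0 < n v then -(D + η) else -(D - η)) else 0) ≤ 0
    have h : ∀ v : T, (if n v ≤ k then (if 0 < n v then -(D + η) else -(D - η)) else 0) =
        if n v ≤ k then -(D - η) else 0 := by
      intro v
      split_ifs <;> first | rfl | omega
    simp_rw [h]
    rw [Finset.sum_coe_sort T (fun v => if n v ≤ k then -(D - η) else 0),
      ← Finset.sum_filter (s := T),
      Finset.sum_const, nsmul_eq_mul]
    linarith [hneg k hk]
  · intro k hk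
    rw [Fintype.sum_sum_type]
    change 0 ≤ ∑ e, (if k < m e then a e else 0) +
      ∑ v : T, (if k < n v then (if 0 < n v then -(D + η) else -(D - η)) else 0)
    have h : ∀ v : T, (if k < n v then (if 0 < n v then -(D + η) else -(D - η)) else 0) =
        if k < n v then -(D + η) else 0 := by
      intro v
      split_ifs <;> first | rfl | omega
    simp_rw [h]
    rw [Finset.sum_coe_sort T (fun v => if k < n v then -(D + η) else 0),
      ← Finset.sum_filter (s := T),
      Finset.sum_const, nsmul_eq_mul]
    linarith [hpos k hk]

/-- A monotone family of dyadic comparisons determines the dyadic scale of `x`. -/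
theorem exists_dyadic_level {Q : ℤ → Prop} (hmono : ∀ k l, k ≤ l → Q k → Q l) {x C : ℝ}
    (hx : 0 < x) (hle : ∀ k, Q k → x ≤ C * 2 ^ k) (hge : ∀ k, ¬Q k → 2 ^ k ≤ x) :
    ∃ m : ℤ, (∀ k, Q k ↔ m ≤ k) ∧ 2 ^ m ≤ 2 * x ∧ x ≤ C * 2 ^ m := by
  have hup : ∃ k, Q k := by
    by_contra h
    push Not at h
    obtain ⟨n, hn⟩ := pow_unbounded_of_one_lt x (one_lt_two (α := ℝ))
    have := hge n (h n)
    rw [zpow_natCast] at this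
    linarith
  have hlow : ∃ b : ℤ, ∀ k, Q k → b ≤ k := by
    have hC : 0 < C := by
      obtain ⟨k, hk⟩ := hup
      have h1 : 0 < C * (2 : ℝ) ^ k := hx.trans_le (hle k hk)
      exact pos_of_mul_pos_left h1 (by positivity)
    obtain ⟨n, hn⟩ := pow_unbounded_of_one_lt (C / x) (one_lt_two (α := ℝ))
    refine ⟨-n, fun k hk => ?_⟩
    by_contra hlt
    have h1 := hle _ (hmono k (-n) (by omega) hk)
    rw [zpow_neg, zpow_natCast] at h1
    rw [div_lt_iff₀ hx] at hn
    have h2 : (0 : ℝ) < 2 ^ n := by positivity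
    have h3 : x * 2 ^ n ≤ C := by
      calc x * 2 ^ n ≤ C * (2 ^ n)⁻¹ * 2 ^ n := by gcongr
        _ = C := by field_simp
    linarith
  obtain ⟨b, hb⟩ := hlow
  obtain ⟨m, hm, hmin⟩ := Int.exists_least_of_bdd ⟨b, fun z hz => hb z hz⟩ hup
  refine ⟨m, fun k => ⟨fun hk => hmin k hk, fun hk => hmono m k hk hm⟩, ?_, hle m hm⟩
  have h := hge (m - 1) (fun h => by have := hmin _ h; omega)
  rw [zpow_sub_one₀ two_ne_zero] at h
  linarith

theorem rpow_neg_le_of_dyadic {x C a : ℝ} {m : ℤ} (hx : 0 < x) (h1 : 2 ^ m ≤ 2 * x)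
    (h2 : x ≤ C * 2 ^ m) : x ^ (-a) ≤ (max C 2) ^ |a| * 2 ^ (-(a * m)) := by
  have h2m : (0 : ℝ) < 2 ^ m := by positivity
  have hB : 0 < max C 2 := lt_max_of_lt_right two_pos
  have hpow : (2 : ℝ) ^ (-(a * m)) = ((2 : ℝ) ^ m) ^ (-a) := by
    rw [← Real.rpow_intCast, ← Real.rpow_mul two_pos.le]
    ring_nf
  rw [hpow]
  rcases le_total 0 a with ha | ha
  · rw [abs_of_nonneg ha]
    have h3 : (max C 2)⁻¹ * 2 ^ m ≤ x := by
      rw [inv_mul_le_iff₀ hB]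
      calc (2 : ℝ) ^ m ≤ 2 * x := h1
        _ ≤ max C 2 * x := by gcongr; exact le_max_right _ _
    calc x ^ (-a) ≤ ((max C 2)⁻¹ * 2 ^ m) ^ (-a) :=
          Real.rpow_le_rpow_of_nonpos (by positivity) h3 (by linarith)
      _ = _ := by
          rw [Real.mul_rpow (by positivity) (by positivity), Real.inv_rpow hB.le,
            Real.rpow_neg hB.le, inv_inv]
  · rw [abs_of_nonpos ha, ← Real.mul_rpow hB.le h2m.le]
    refine Real.rpow_le_rpow hx.le (h2.trans ?_) (by linarith)
    gcongr
    exact le_max_left _ _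

/-- A radial profile which is integrable near the origin and near infinity of a space of
dimension `D`. -/
def radialProfile (D η r : ℝ) : ℝ := min (r ^ (-(D - η))) (r ^ (-(D + η)))

theorem dyadic_le_radialProfile {D η x : ℝ} {m : ℤ} (hη : 0 ≤ η) (hD : η ≤ D) (hx : 0 < x)
    (h : x ≤ 2 ^ m) : (2 : ℝ) ^ (-(D * m + η * |(m : ℝ)|)) ≤ radialProfile D η x := by
  have key : ∀ b : ℝ, 0 ≤ b → b * m ≤ D * m + η * |(m : ℝ)| →
      (2 : ℝ) ^ (-(D * m + η * |(m : ℝ)|)) ≤ x ^ (-b) := by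
    intro b hb hbm
    calc (2 : ℝ) ^ (-(D * m + η * |(m : ℝ)|)) ≤ 2 ^ (-(b * m)) :=
          Real.rpow_le_rpow_of_exponent_le one_le_two (by linarith)
      _ = ((2 : ℝ) ^ m) ^ (-b) := by
          rw [← Real.rpow_intCast, ← Real.rpow_mul two_pos.le]
          ring_nf
      _ ≤ x ^ (-b) := Real.rpow_le_rpow_of_nonpos hx h (by linarith)
  refine le_min (key _ (by linarith) ?_) (key _ (by linarith) ?_)
  · nlinarith [neg_abs_le (m : ℝ)]
  · nlinarith [le_abs_self (m : ℝ)]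

section PowerCounting

variable {V ε : Type*} [Fintype V] [DecidableEq V] [Fintype ε] {ends : ε → V × V} {a : ε → ℝ}
  {A : Finset V} {D η : ℝ}

/-- The total weight of the edges inside the fibers of an idempotent map `R` over a set `B` of
fixed points. -/
theorem sum_fiber_le
    (hUV : ∀ S : Finset V, S.Nonempty → (S ∩ A).card ≤ 1 →
      ∑ e with (ends e).1 ∈ S ∧ (ends e).2 ∈ S, a e ≤ (D - η) * (S.card - 1))
    {R : V → V} (hRA : ∀ v ∈ A, R v = v) {B : Finset V} (hB : ∀ r ∈ B, R r = r) :
    ∑ e with R (ends e).1 = R (ends e).2 ∧ R (ends e).1 ∈ B, a e ≤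
      (D - η) * ((Finset.univ.filter fun v => R v ∈ B).card - B.card) := by
  have hmaps : ∀ e ∈ Finset.univ.filter
      (fun e => R (ends e).1 = R (ends e).2 ∧ R (ends e).1 ∈ B), R (ends e).1 ∈ B := by
    intro e he
    exact (Finset.mem_filter.1 he).2.2
  have hcard : ((Finset.univ.filter fun v => R v ∈ B).card : ℝ) =
      ∑ r ∈ B, ((Finset.univ.filter fun v => R v = r).card : ℝ) := by
    rw [Finset.card_eq_sum_card_fiberwise (f := R) (t := B) (by intro v hv; simpa using hv)]
    push_cast
    refine Finset.sum_congr rfl fun r hr => ?_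
    congr 2
    ext v
    simp only [Finset.mem_filter, Finset.mem_univ, true_and]
    exact ⟨fun h => h.2, fun h => ⟨h ▸ hr, h⟩⟩
  rw [← Finset.sum_fiberwise_of_maps_to hmaps, hcard, Finset.cast_card, ← Finset.sum_sub_distrib,
    Finset.mul_sum]
  refine Finset.sum_le_sum fun r hr => ?_
  refine le_trans (le_of_eq ?_) (hUV (Finset.univ.filter fun v => R v = r) ⟨r, by simp [hB r hr]⟩ ?_)
  · rw [Finset.filter_filter]
    refine Finset.sum_congr ?_ fun _ _ => rfl
    ext e
    simp only [Finset.mem_filter, Finset.mem_univ, true_and]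
    constructor
    · rintro ⟨⟨h1, -⟩, h3⟩
      exact ⟨h3, h1 ▸ h3⟩
    · rintro ⟨h1, h2⟩
      exact ⟨⟨h1.trans h2.symm, h1 ▸ hr⟩, h1⟩
  · rw [Finset.card_le_one]
    intro u hu w hw
    simp only [Finset.mem_inter, Finset.mem_filter, Finset.mem_univ, true_and] at hu hw
    rw [← hRA u hu.2, ← hRA w hw.2, hu.1, hw.1]

/-- Power counting at small scales. -/
theorem sum_same_root_le
    (hUV : ∀ S : Finset V, S.Nonempty → (S ∩ A).card ≤ 1 →
      ∑ e with (ends e).1 ∈ S ∧ (ends e).2 ∈ S, a e ≤ (D - η) * (S.card - 1))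
    {R : V → V} (hR : ∀ v, R (R v) = R v) (hRA : ∀ v ∈ A, R v = v) :
    ∑ e, (if R (ends e).1 = R (ends e).2 then a e else 0) ≤
      (D - η) * (Aᶜ.filter fun v => R v ≠ v).card := by
  have h := sum_fiber_le hUV hRA (B := Finset.univ.filter fun v => R v = v) (by simp)
  simp only [Finset.mem_filter, Finset.mem_univ, hR, and_true, Finset.filter_true] at h
  rw [← Finset.sum_filter]
  refine h.trans (le_of_eq ?_)
  congr 1
  have h2 : (Aᶜ.filter fun v => R v ≠ v) = Finset.univ.filter fun v => ¬R v = v := by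
    ext v
    simp only [Finset.mem_filter, Finset.mem_compl, Finset.mem_univ, true_and]
    exact ⟨fun h => h.2, fun h => ⟨fun hv => h (hRA v hv), h⟩⟩
  rw [h2, sub_eq_iff_eq_add, add_comm, ← Nat.cast_add, Finset.card_filter_add_card_filter_not]

/-- Power counting at large scales. -/
theorem le_sum_different_root
    (hUV : ∀ S : Finset V, S.Nonempty → (S ∩ A).card ≤ 1 →
      ∑ e with (ends e).1 ∈ S ∧ (ends e).2 ∈ S, a e ≤ (D - η) * (S.card - 1))
    (hIR : ∀ S : Finset V, S.Nonempty → Disjoint S A →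
      D * S.card + η * Fintype.card V ≤ ∑ e with (ends e).1 ∈ S ∨ (ends e).2 ∈ S, a e)
    (hη : 0 ≤ η) {R : V → V} (hR : ∀ v, R (R v) = R v) (hRA : ∀ v ∈ A, R v = v) :
    (D + η) * (Aᶜ.filter fun v => R v = v).card ≤
      ∑ e, (if ¬(R (ends e).1 = R (ends e).2 ∨ R (ends e).1 ∈ A ∧ R (ends e).2 ∈ A)
        then a e else 0) := by
  set B := Aᶜ.filter fun v => R v = v with hBdef
  set S := Finset.univ.filter fun v => R v ∉ A with hSdef
  have hSB : (Finset.univ.filter fun v => R v ∈ B) = S := by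
    ext v
    simp [hBdef, hSdef, hR]
  have hBcard : (B.card : ℝ) ≤ S.card := by
    have : B ⊆ S := by
      intro v hv
      simp only [hBdef, hSdef, Finset.mem_filter, Finset.mem_compl, Finset.mem_univ,
        true_and] at hv ⊢
      rw [hv.2]
      exact hv.1
    exact_mod_cast Finset.card_le_card this
  have hBV : (B.card : ℝ) ≤ Fintype.card V := by exact_mod_cast Finset.card_le_univ B
  have hwithin := sum_fiber_le hUV hRA (B := B) (by
    intro r hr
    exact (Finset.mem_filter.1 hr).2)
  rw [hSB] at hwithin
  have hdisj : Disjoint S A := by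
    rw [Finset.disjoint_left]
    intro v hv hvA
    simp only [hSdef, Finset.mem_filter, Finset.mem_univ, true_and] at hv
    rw [hRA v hvA] at hv
    exact hv hvA
  have hsplit : ∑ e with (ends e).1 ∈ S ∨ (ends e).2 ∈ S, a e =
      ∑ e, (if ¬(R (ends e).1 = R (ends e).2 ∨ R (ends e).1 ∈ A ∧ R (ends e).2 ∈ A)
        then a e else 0) +
      ∑ e with R (ends e).1 = R (ends e).2 ∧ R (ends e).1 ∈ B, a e := by
    rw [Finset.sum_filter, Finset.sum_filter, ← Finset.sum_add_distrib]
    refine Finset.sum_congr rfl fun e _ => ?_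
    have h1 : ∀ v, v ∈ S ↔ R v ∉ A := by simp [hSdef]
    have h2 : ∀ v, R v ∈ B ↔ R v ∉ A := by simp [hBdef, hR]
    simp only [h1, h2]
    by_cases hEq : R (ends e).1 = R (ends e).2
    · simp [hEq]
    · by_cases h3 : R (ends e).1 ∈ A <;> by_cases h4 : R (ends e).2 ∈ A <;> simp [hEq, h3, h4]
  rcases S.eq_empty_or_nonempty with hS | hS
  · have hB0 : B.card = 0 := by
      rw [hS, Finset.card_empty] at hBcard
      have : B.card ≤ 0 := by exact_mod_cast hBcard
      omega
    have hBe : B = ∅ := Finset.card_eq_zero.1 hB0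
    rw [hS, hBe] at hsplit
    simp only [Finset.notMem_empty, or_self, and_false, Finset.filter_false, Finset.sum_empty,
      add_zero] at hsplit
    rw [← hsplit, hB0]
    simp
  · have h := hIR S hS hdisj
    nlinarith [mul_le_mul_of_nonneg_left hBV hη,
      mul_nonneg hη (sub_nonneg.2 hBcard)]

/-- **Pointwise power counting.** The product of powers of the distances of a configuration is
bounded by a product of radial profiles over a forest rooted at the set `A`. -/
theorem exists_forest_bound {E : Type*} [MetricSpace E] (hends : ∀ e, (ends e).1 ≠ (ends e).2)
    (hA : A.Nonempty) (hη : 0 ≤ η) (hηD : η ≤ D)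
    (hUV : ∀ S : Finset V, S.Nonempty → (S ∩ A).card ≤ 1 →
      ∑ e with (ends e).1 ∈ S ∧ (ends e).2 ∈ S, a e ≤ (D - η) * (S.card - 1))
    (hIR : ∀ S : Finset V, S.Nonempty → Disjoint S A →
      D * S.card + η * Fintype.card V ≤ ∑ e with (ends e).1 ∈ S ∨ (ends e).2 ∈ S, a e)
    {L : ℝ} (hL : 0 ≤ L) :
    ∃ K : ℝ, 0 ≤ K ∧ ∀ x : V → E, Function.Injective x →
      (∀ u ∈ A, ∀ v ∈ A, u ≠ v → 2 * (Aᶜ.card : ℝ) + 1 ≤ dist (x u) (x v)) →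
      (∀ u ∈ A, ∀ v ∈ A, dist (x u) (x v) ≤ L) →
      ∃ (idx : V → ℕ) (p : V → V), (∀ v ∉ A, idx (p v) < idx v) ∧
        ∏ e, dist (x (ends e).1) (x (ends e).2) ^ (-a e) ≤
          K * ∏ v ∈ Aᶜ, radialProfile D η (dist (x v) (x (p v))) := by
  set N : ℝ := (Aᶜ.card : ℝ) with hN
  have hN0 : 0 ≤ N := by positivity
  set C : ℝ := 2 * N + L with hC
  refine ⟨∏ e, (max C 2) ^ |a e|, Finset.prod_nonneg fun e _ => by positivity, ?_⟩
  intro x hx hsep hdiam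
  obtain ⟨P⟩ := PrimOrder.exists_primOrder (fun u v => dist (x u) (x v)) A hA
  refine ⟨P.idx, P.parent, P.idx_parent_lt, ?_⟩
  have hsymm : ∀ u v, dist (x u) (x v) = dist (x v) (x u) := fun u v => dist_comm _ _
  have hroot : ∀ {s : ℝ}, 0 ≤ s → ∀ v, dist (x v) (x (P.root s v)) ≤ N * s := fun hs v =>
    P.dist_root_le (fun _ => dist_self _) (fun _ _ _ => dist_triangle _ _ _) hs v
  -- the relation of being connected at the scale `2 ^ k`, all of `A` being joined from scale `1`
  let Q : ℤ → V → V → Prop := fun k u w =>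
    P.root (2 ^ k) u = P.root (2 ^ k) w ∨
      0 ≤ k ∧ P.root (2 ^ k) u ∈ A ∧ P.root (2 ^ k) w ∈ A
  have hQmono : ∀ u w k l, k ≤ l → Q k u w → Q l u w := by
    intro u w k l hkl h
    have h2 : (2 : ℝ) ^ k ≤ 2 ^ l := zpow_le_zpow_right₀ one_le_two hkl
    rcases h with h | ⟨hk, hu, hw⟩
    · left
      rw [← P.root_root h2, h, P.root_root h2]
    · right
      refine ⟨hk.trans hkl, ?_, ?_⟩
      · rwa [P.root_mem_of_le h2 hu]
      · rwa [P.root_mem_of_le h2 hw]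
  have hdist : ∀ (k : ℤ) u w, dist (x u) (x w) ≤ 2 * N * 2 ^ k +
      dist (x (P.root (2 ^ k) u)) (x (P.root (2 ^ k) w)) := by
    intro k u w
    have h0 : (0 : ℝ) ≤ 2 ^ k := by positivity
    have h1 := dist_triangle4 (x u) (x (P.root (2 ^ k) u)) (x (P.root (2 ^ k) w)) (x w)
    have h2 := hroot h0 u
    have h3 := hroot h0 w
    rw [dist_comm] at h3
    linarith
  have hQle : ∀ u w k, Q k u w → dist (x u) (x w) ≤ C * 2 ^ k := by
    intro u w k h
    have h0 : (0 : ℝ) < 2 ^ k := by positivity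
    have h1 := hdist k u w
    rcases h with h | ⟨hk, hu, hw⟩
    · rw [h, dist_self] at h1
      nlinarith [mul_nonneg hL h0.le]
    · have h2 := hdiam _ hu _ hw
      have h3 : (1 : ℝ) ≤ 2 ^ k := one_le_zpow₀ one_le_two hk
      nlinarith [mul_le_mul_of_nonneg_left h3 hL]
  have hQge : ∀ u w k, ¬Q k u w → (2 : ℝ) ^ k ≤ dist (x u) (x w) := by
    intro u w k h
    simp only [Q, not_or] at h
    by_cases hAA : P.root (2 ^ k) u ∈ A ∧ P.root (2 ^ k) w ∈ A
    · have hk : k ≤ 0 := by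
        by_contra hk
        exact h.2 ⟨by omega, hAA⟩
      have h0 : (0 : ℝ) ≤ 2 ^ k := by positivity
      have h1 : (2 : ℝ) ^ k ≤ 1 := zpow_le_one_of_nonpos₀ one_le_two hk
      have h2 := hsep _ hAA.1 _ hAA.2 h.1
      have h3 := dist_triangle4 (x (P.root (2 ^ k) u)) (x u) (x w) (x (P.root (2 ^ k) w))
      have h4 := hroot h0 u
      have h5 := hroot h0 w
      rw [dist_comm] at h4
      nlinarith [mul_le_mul_of_nonneg_left h1 hN0]
    · exact (P.lt_of_root_ne hsymm h.1 hAA).le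
  have hpos : ∀ u w, u ≠ w → 0 < dist (x u) (x w) := fun u w h => dist_pos.2 (hx.ne h)
  have hparent : ∀ v, v ∉ A → v ≠ P.parent v := fun v hv h => by
    have := P.idx_parent_lt v hv
    rw [← h] at this
    omega
  have hm : ∀ e, ∃ m : ℤ, (∀ k, Q k (ends e).1 (ends e).2 ↔ m ≤ k) ∧
      2 ^ m ≤ 2 * dist (x (ends e).1) (x (ends e).2) ∧
      dist (x (ends e).1) (x (ends e).2) ≤ C * 2 ^ m := fun e =>
    exists_dyadic_level (hQmono _ _) (hpos _ _ (hends e)) (hQle _ _) (hQge _ _)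
  have hn : ∀ v, ∃ m : ℤ, v ∉ A → (∀ k, P.len v ≤ 2 ^ k ↔ m ≤ k) ∧ P.len v ≤ 2 ^ m := by
    intro v
    by_cases hv : v ∈ A
    · exact ⟨0, fun h => absurd hv h⟩
    · obtain ⟨m, h1, -, h3⟩ := exists_dyadic_level (Q := fun k => P.len v ≤ 2 ^ k) (C := 1)
        (fun k l hkl h => h.trans (zpow_le_zpow_right₀ one_le_two hkl))
        (hpos v (P.parent v) (hparent v hv)) (fun k hk => by rw [one_mul]; exact hk)
        (fun k hk => (not_le.1 hk).le)
      exact ⟨m, fun _ => ⟨h1, by rw [one_mul] at h3; exact h3⟩⟩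
  choose m hmQ hm1 hm2 using hm
  choose n hn using hn
  have hfix : ∀ (k : ℤ) v, v ∉ A → (P.root (2 ^ k) v = v ↔ k < n v) := by
    intro k v hv
    rw [P.root_eq_self_iff, ← not_le, ((hn v hv).1 k), not_le]
    simp [hv]
  have hlevel := sum_level_le_sum_level a m Aᶜ n D η ?_ ?_
  · calc ∏ e, dist (x (ends e).1) (x (ends e).2) ^ (-a e)
        ≤ ∏ e, ((max C 2) ^ |a e| * (2 : ℝ) ^ (-(a e * m e))) :=
          Finset.prod_le_prod (fun e _ => by positivity) fun e _ =>
            rpow_neg_le_of_dyadic (hpos _ _ (hends e)) (hm1 e) (hm2 e)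
      _ = (∏ e, (max C 2) ^ |a e|) * (2 : ℝ) ^ (-∑ e, a e * m e) := by
          rw [Finset.prod_mul_distrib, ← Real.rpow_sum_of_pos two_pos, Finset.sum_neg_distrib]
      _ ≤ (∏ e, (max C 2) ^ |a e|) *
            (2 : ℝ) ^ (-∑ v ∈ Aᶜ, (D * n v + η * |(n v : ℝ)|)) := by
          gcongr
          exact one_le_two
      _ = (∏ e, (max C 2) ^ |a e|) *
            ∏ v ∈ Aᶜ, (2 : ℝ) ^ (-(D * n v + η * |(n v : ℝ)|)) := by
          rw [← Real.rpow_sum_of_pos two_pos, Finset.sum_neg_distrib]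
      _ ≤ _ := by
          gcongr with v hv
          have hv' : v ∉ A := by simpa using hv
          exact dyadic_le_radialProfile hη hηD (hpos _ _ (hparent v hv')) (hn v hv').2
  · intro k hk
    have h := sum_same_root_le hUV (R := P.root (2 ^ k)) (fun v => P.root_root le_rfl v)
      (fun v hv => P.root_of_mem (Or.inl hv))
    have h1 : (Aᶜ.filter fun v => n v ≤ k) = Aᶜ.filter fun v => P.root (2 ^ k) v ≠ v := by
      refine Finset.filter_congr fun v hv => ?_
      rw [ne_eq, hfix k v (by simpa using hv), not_lt]
    rw [h1]
    refine le_trans (le_of_eq (Finset.sum_congr rfl fun e _ => ?_)) h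
    refine if_congr ?_ rfl rfl
    rw [← hmQ e k]
    simp only [Q, not_le.2 hk, false_and, or_false]
  · intro k hk
    have h := le_sum_different_root hUV hIR hη (R := P.root (2 ^ k))
      (fun v => P.root_root le_rfl v) (fun v hv => P.root_of_mem (Or.inl hv))
    have h1 : (Aᶜ.filter fun v => k < n v) = Aᶜ.filter fun v => P.root (2 ^ k) v = v :=
      Finset.filter_congr fun v hv => (hfix k v (by simpa using hv)).symm
    rw [h1]
    refine le_trans h (le_of_eq (Finset.sum_congr rfl fun e _ => ?_))
    refine if_congr ?_ rfl rfl
    rw [← not_le, ← hmQ e k]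
    simp only [Q, hk, true_and]

end PowerCounting

/-- A product of functions of differences along a forest integrates to a product. -/
theorem lintegral_prod_forest {ι E : Type*} [Fintype ι] [MeasureSpace E]
    [SigmaFinite (volume : Measure E)] [AddGroup E] [MeasurableSub₂ E] [MeasurableAdd E]
    [(volume : Measure E).IsAddRightInvariant]
    {g : ι → E → ℝ≥0∞} (hg : ∀ i, Measurable (g i))
    {c : ι → (ι → E) → E} (hc : ∀ i, Measurable (c i))
    (rank : ι → ℕ) (hrank : ∀ i j, rank i ≤ rank j → ∀ y t, c i (Function.update y j t) = c i y) :
    ∫⁻ y : ι → E, ∏ i, g i (y i - c i y) = ∏ i, ∫⁻ t, g i t := by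
  have hmeas : ∀ s : Finset ι, Measurable fun y : ι → E => ∏ i ∈ s, g i (y i - c i y) := fun s =>
    Finset.measurable_prod _ fun i _ => (hg i).comp ((measurable_pi_apply i).sub (hc i))
  have key : ∀ s : Finset ι, ∀ y : ι → E,
      (∫⋯∫⁻_s, (fun y : ι → E => ∏ i ∈ s, g i (y i - c i y)) ∂fun _ => volume) y =
        ∏ i ∈ s, ∫⁻ t, g i t := by
    intro s
    induction s using Finset.induction_on_max_value rank with
    | empty => simp
    | insert i s hi hmax ih =>
      intro y
      rw [lmarginal_insert' _ (hmeas _) hi]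
      have hinner : ∀ y : ι → E,
          ∫⁻ t, ∏ j ∈ insert i s, g j (Function.update y i t j - c j (Function.update y i t)) =
            (∫⁻ t, g i t) * ∏ j ∈ s, g j (y j - c j y) := by
        intro y
        have h1 : ∀ t, ∏ j ∈ insert i s,
            g j (Function.update y i t j - c j (Function.update y i t)) =
            g i (t - c i y) * ∏ j ∈ s, g j (y j - c j y) := by
          intro t
          rw [Finset.prod_insert hi, Function.update_self, hrank i i le_rfl]
          congr 1
          refine Finset.prod_congr rfl fun j hj => ?_
          rw [hrank j i (hmax j hj), Function.update_of_ne]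
          rintro rfl
          exact hi hj
        simp_rw [h1]
        have h2 : Measurable fun t => g i (t - c i y) := (hg i).comp (measurable_id.sub_const _)
        rw [lintegral_mul_const _ h2, lintegral_sub_right_eq_self (g i)]
      simp_rw [hinner]
      simp only [lmarginal] at ih ⊢
      have h3 : Measurable fun u : s → E => ∏ j ∈ s,
          g j (Function.updateFinset y s u j - c j (Function.updateFinset y s u)) :=
        (hmeas s).comp measurable_updateFinset
      rw [lintegral_const_mul _ h3, ih, Finset.prod_insert hi]
  rw [volume_pi, lintegral_eq_lmarginal_univ (fun _ => 0)]
  exact key Finset.univ _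

theorem integrable_radialProfile_norm {E : Type*} [NormedAddCommGroup E] [NormedSpace ℝ E]
    [FiniteDimensional ℝ E] [Nontrivial E] [MeasurableSpace E] [BorelSpace E] (μ : Measure E)
    [μ.IsAddHaarMeasure] {η : ℝ} (hη : 0 < η) :
    Integrable (fun x : E => radialProfile (Module.finrank ℝ E) η ‖x‖) μ := by
  rw [integrable_fun_norm_addHaar μ (f := radialProfile (Module.finrank ℝ E) η)]
  set n := Module.finrank ℝ E with hn
  have hn1 : 1 ≤ n := Module.finrank_pos
  have hmeas : Measurable fun y : ℝ => y ^ (n - 1) • radialProfile n η y := by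
    unfold radialProfile
    fun_prop
  have hpow : ∀ (b : ℝ) {y : ℝ}, 0 < y → y ^ (n - 1) * y ^ (-(n + b)) = y ^ (-1 - b) := by
    intro b y hy
    rw [← Real.rpow_natCast, ← Real.rpow_add hy]
    congr 1
    push_cast [hn1]
    ring
  have hnonneg : ∀ {y : ℝ}, 0 < y → 0 ≤ y ^ (n - 1) • radialProfile n η y := by
    intro y hy
    unfold radialProfile
    positivity
  rw [← Set.Ioc_union_Ioi_eq_Ioi zero_le_one, integrableOn_union]
  constructor
  · have h1 : IntegrableOn (fun y : ℝ => y ^ (-1 - -η)) (Set.Ioc 0 1) := by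
      rw [← intervalIntegrable_iff_integrableOn_Ioc_of_le zero_le_one]
      exact intervalIntegral.intervalIntegrable_rpow' (by linarith)
    refine Integrable.mono' h1 hmeas.aestronglyMeasurable ?_
    filter_upwards [ae_restrict_mem measurableSet_Ioc] with y hy
    rw [Real.norm_of_nonneg (hnonneg hy.1), ← hpow _ hy.1, smul_eq_mul]
    have := hy.1
    gcongr
    exact min_le_left _ _
  · have h1 : IntegrableOn (fun y : ℝ => y ^ (-1 - η)) (Set.Ioi 1) :=
      integrableOn_Ioi_rpow_of_lt (by linarith) one_pos
    refine Integrable.mono' h1 hmeas.aestronglyMeasurable ?_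
    filter_upwards [ae_restrict_mem measurableSet_Ioi] with y hy
    have hy0 : 0 < y := one_pos.trans hy
    rw [Real.norm_of_nonneg (hnonneg hy0), ← hpow _ hy0, smul_eq_mul]
    gcongr
    exact min_le_right _ _

namespace FeynmanGraph

variable {d nV nE : ℕ} {G : FeynmanGraph nV nE}

theorem UVConvergent.sum_lt (hUV : G.UVConvergent d) {S : Finset (Fin nV)} (hS : 2 ≤ S.card)
    (hSA : (S ∩ G.ext).card ≤ 1) :
    ∑ e with (G.ends e).1 ∈ S ∧ (G.ends e).2 ∈ S, 2 * lam d * G.ν e < d * (S.card - 1) := by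
  have := hUV S hS hSA
  rw [edgesWithin] at this
  rw [← Finset.mul_sum]
  linarith

theorem IRConvergent.lt_sum (hIR : G.IRConvergent d) {S : Finset (Fin nV)} (hS : S.Nonempty)
    (hSA : Disjoint S G.ext) :
    d * S.card < ∑ e with (G.ends e).1 ∈ S ∨ (G.ends e).2 ∈ S, 2 * lam d * G.ν e := by
  set Eg : Finset (Fin nE) := {e | (G.ends e).1 ∈ S ∨ (G.ends e).2 ∈ S} with hEg
  have hint : ∀ v ∈ S, G.GInternal Finset.univ Eg v := by
    refine fun v hv => ⟨Finset.disjoint_left.1 hSA hv, Finset.mem_univ _, fun e he => ?_⟩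
    rw [hEg, Finset.mem_filter]
    refine ⟨Finset.mem_univ _, ?_⟩
    rcases he with rfl | rfl
    exacts [Or.inl hv, Or.inr hv]
  have hsub : S ⊆ G.gInternalSet Finset.univ Eg := fun v hv =>
    Finset.mem_filter.2 ⟨Finset.mem_univ _, hint v hv⟩
  have h := hIR Finset.univ Eg (fun _ _ => ⟨Finset.mem_univ _, Finset.mem_univ _⟩)
    (hS.mono hsub).card_pos fun e he =>
      (Finset.mem_filter.1 he).2.imp (hint _) (hint _)
  have hcard : (S.card : ℝ) ≤ (G.gInternalSet Finset.univ Eg).card := by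
    exact_mod_cast Finset.card_le_card hsub
  have hd0 : (0 : ℝ) ≤ d := by positivity
  rw [← Finset.mul_sum]
  nlinarith [mul_le_mul_of_nonneg_left hcard hd0]

/-- Convergence holds with a uniform margin. -/
theorem exists_margin (hd : 2 < d) (hUV : G.UVConvergent d) (hIR : G.IRConvergent d) :
    ∃ η : ℝ, 0 < η ∧ η ≤ d ∧
      (∀ S : Finset (Fin nV), S.Nonempty → (S ∩ G.ext).card ≤ 1 →
        ∑ e with (G.ends e).1 ∈ S ∧ (G.ends e).2 ∈ S, 2 * lam d * G.ν e ≤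
          (d - η) * (S.card - 1)) ∧
      (∀ S : Finset (Fin nV), S.Nonempty → Disjoint S G.ext →
        d * S.card + η * Fintype.card (Fin nV) ≤
          ∑ e with (G.ends e).1 ∈ S ∨ (G.ends e).2 ∈ S, 2 * lam d * G.ν e) := by
  have hd0 : (0 : ℝ) < d := by positivity
  have h1 : ∀ᶠ η : ℝ in nhdsWithin 0 (Set.Ioi 0), ∀ S : Finset (Fin nV),
      S.Nonempty → (S ∩ G.ext).card ≤ 1 →
        ∑ e with (G.ends e).1 ∈ S ∧ (G.ends e).2 ∈ S, 2 * lam d * G.ν e ≤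
          (d - η) * (S.card - 1) := by
    refine Filter.eventually_all.2 fun S => ?_
    rcases Nat.lt_or_ge S.card 2 with hS | hS
    · refine Filter.Eventually.of_forall fun η hne _ => ?_
      obtain ⟨v, rfl⟩ := Finset.card_eq_one.1 (show S.card = 1 by have := hne.card_pos; omega)
      rw [Finset.sum_eq_zero]
      · simp
      · intro e he
        simp only [Finset.mem_filter, Finset.mem_singleton] at he
        exact absurd (he.2.1.trans he.2.2.symm) (G.ends_ne e)
    · by_cases hSA : (S ∩ G.ext).card ≤ 1
      · have hc : Continuous fun η : ℝ => ((d : ℝ) - η) * (S.card - 1) := by fun_prop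
        have hlt := hUV.sum_lt hS hSA
        have := (hc.tendsto 0).eventually_const_lt (by simpa using hlt)
        filter_upwards [nhdsWithin_le_nhds this] with η h _ _ using h.le
      · exact Filter.Eventually.of_forall fun η _ h => absurd h hSA
  have h2 : ∀ᶠ η : ℝ in nhdsWithin 0 (Set.Ioi 0), ∀ S : Finset (Fin nV),
      S.Nonempty → Disjoint S G.ext →
        d * S.card + η * Fintype.card (Fin nV) ≤
          ∑ e with (G.ends e).1 ∈ S ∨ (G.ends e).2 ∈ S, 2 * lam d * G.ν e := by
    refine Filter.eventually_all.2 fun S => ?_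
    by_cases hS : S.Nonempty ∧ Disjoint S G.ext
    · have hc : Continuous fun η : ℝ => (d : ℝ) * S.card + η * Fintype.card (Fin nV) := by fun_prop
      have hlt := hIR.lt_sum hS.1 hS.2
      have := (hc.tendsto 0).eventually_lt_const (by simpa using hlt)
      filter_upwards [nhdsWithin_le_nhds this] with η h _ _ using h.le
    · exact Filter.Eventually.of_forall fun η ha hb => absurd ⟨ha, hb⟩ hS
  have h3 : ∀ᶠ η : ℝ in nhdsWithin 0 (Set.Ioi 0), η ≤ d :=
    nhdsWithin_le_nhds (Iic_mem_nhds hd0)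
  obtain ⟨η, ⟨⟨hA, hB⟩, hC⟩, hD⟩ := (((h1.and h2).and h3).and self_mem_nhdsWithin).exists
  exact ⟨η, hD, hC, hA, hB⟩

/-- The integrand of the position space integral. -/
def integrand (G : FeynmanGraph nV nE) (x : Fin nV → EuclideanSpace ℝ (Fin d))
    (y : {v : Fin nV // v ∉ G.ext} → EuclideanSpace ℝ (Fin d)) : ℝ :=
  ∏ e, ‖G.assemble x y (G.ends e).1 - G.assemble x y (G.ends e).2‖ ^ (-(2 * lam d * G.ν e))

theorem assemble_of_mem {E : Type*} {v : Fin nV} (hv : v ∈ G.ext) (x : Fin nV → E)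
    (y : {v : Fin nV // v ∉ G.ext} → E) : G.assemble x y v = x v := by
  simp [assemble, hv]

theorem assemble_coe {E : Type*} (x : Fin nV → E)
    (y : {v : Fin nV // v ∉ G.ext} → E) (v : {v : Fin nV // v ∉ G.ext}) :
    G.assemble x y v = y v := by
  simp [assemble, v.2]

theorem continuous_assemble {E : Type*} [TopologicalSpace E] (x : Fin nV → E) (v : Fin nV) :
    Continuous fun y : {v : Fin nV // v ∉ G.ext} → E => G.assemble x y v := by
  by_cases hv : v ∈ G.ext
  · simpa only [assemble_of_mem hv] using continuous_const
  · simpa only [assemble, hv, not_false_eq_true, dif_pos] using continuous_apply _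

theorem assemble_congr {E : Type*} (x : Fin nV → E) {y y' : {v : Fin nV // v ∉ G.ext} → E}
    {v : Fin nV} (h : ∀ hv : v ∉ G.ext, y ⟨v, hv⟩ = y' ⟨v, hv⟩) :
    G.assemble x y v = G.assemble x y' v := by
  unfold assemble
  split_ifs with hv
  · rfl
  · exact h hv

theorem lintegral_prod_assemble_lt_top (x : Fin nV → EuclideanSpace ℝ (Fin d))
    {g : EuclideanSpace ℝ (Fin d) → ℝ≥0∞} (hg : Measurable g) (hgi : ∫⁻ t, g t ≠ ⊤)
    {idx : Fin nV → ℕ} {p : Fin nV → Fin nV} (hp : ∀ v ∉ G.ext, idx (p v) < idx v) :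
    ∫⁻ y : {v : Fin nV // v ∉ G.ext} → EuclideanSpace ℝ (Fin d),
      ∏ v ∈ G.extᶜ, g (G.assemble x y v - G.assemble x y (p v)) ≠ ⊤ := by
  have hprod : ∀ y : {v : Fin nV // v ∉ G.ext} → EuclideanSpace ℝ (Fin d),
      ∏ v ∈ G.extᶜ, g (G.assemble x y v - G.assemble x y (p v)) =
        ∏ i : {v : Fin nV // v ∉ G.ext}, g (y i - G.assemble x y (p i)) := by
    intro y
    rw [Finset.prod_subtype (F := inferInstance) (p := fun v => v ∉ G.ext) G.extᶜ (by simp)]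
    simp only [assemble_coe]
  simp_rw [hprod]
  rw [lintegral_prod_forest (fun _ => hg) (c := fun i y => G.assemble x y (p i))
    (fun i => (continuous_assemble x _).measurable) (fun i => idx i)]
  · exact ENNReal.prod_ne_top fun _ _ => hgi
  · intro i j hij y t
    have hne : p i ≠ j := by
      intro h
      have := hp i i.2
      rw [h] at this
      omega
    refine assemble_congr x fun h => ?_
    exact @Function.update_of_ne _ _ (_) _ _ (fun h => hne (congrArg Subtype.val h)) _ _

/-- The position space integral of a convergent graph is finite. -/
theorem lintegral_integrand_ne_top (hd : 2 < d) (hUV : G.UVConvergent d) (hIR : G.IRConvergent d)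
    (hA : G.ext.Nonempty) {x : Fin nV → EuclideanSpace ℝ (Fin d)} (hx : Set.InjOn x G.ext) :
    ∫⁻ y, ENNReal.ofReal (G.integrand x y) ≠ ⊤ := by
  obtain ⟨η, hη, hηd, hU, hI⟩ := exists_margin hd hUV hIR
  obtain ⟨τ, hτ, hsep⟩ : ∃ τ : ℝ, 0 < τ ∧ ∀ u ∈ G.ext, ∀ v ∈ G.ext, u ≠ v →
      2 * (G.extᶜ.card : ℝ) + 1 ≤ τ * dist (x u) (x v) := by
    have : ∀ᶠ τ : ℝ in Filter.atTop, ∀ u v, u ∈ G.ext → v ∈ G.ext → u ≠ v →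
        2 * (G.extᶜ.card : ℝ) + 1 ≤ τ * dist (x u) (x v) := by
      refine Filter.eventually_all.2 fun u => Filter.eventually_all.2 fun v => ?_
      by_cases h : u ∈ G.ext ∧ v ∈ G.ext ∧ u ≠ v
      · have hpos : 0 < dist (x u) (x v) := dist_pos.2 fun h' => h.2.2 (hx h.1 h.2.1 h')
        filter_upwards [(Filter.tendsto_id.atTop_mul_const hpos).eventually_ge_atTop
          (2 * (G.extᶜ.card : ℝ) + 1)] with τ hτ _ _ _ using hτ
      · exact Filter.Eventually.of_forall fun τ h1 h2 h3 => absurd ⟨h1, h2, h3⟩ h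
    obtain ⟨τ, h1, h2⟩ := (this.and (Filter.eventually_gt_atTop 0)).exists
    exact ⟨τ, h2, fun u hu v hv => h1 u v hu hv⟩
  obtain ⟨L, hL, hdiam⟩ : ∃ L : ℝ, 0 ≤ L ∧ ∀ u v, τ * dist (x u) (x v) ≤ L := by
    refine ⟨∑ u, ∑ v, τ * dist (x u) (x v), by positivity, fun u v => ?_⟩
    exact (Finset.single_le_sum (f := fun v => τ * dist (x u) (x v)) (fun _ _ => by positivity)
      (Finset.mem_univ v)).trans (Finset.single_le_sum
        (f := fun u => ∑ v, τ * dist (x u) (x v)) (fun _ _ => by positivity) (Finset.mem_univ u))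
  obtain ⟨K, hK, hbound⟩ := exists_forest_bound (E := EuclideanSpace ℝ (Fin d))
    (a := fun e => 2 * lam d * G.ν e) (D := d) G.ends_ne hA hη.le hηd hU hI hL
  set g : EuclideanSpace ℝ (Fin d) → ℝ≥0∞ := fun t =>
    if t = 0 then ⊤ else ENNReal.ofReal (radialProfile d η ‖τ • t‖) with hg
  have hrad : ∀ t : EuclideanSpace ℝ (Fin d), t ≠ 0 → 0 < radialProfile d η ‖τ • t‖ := by
    intro t ht
    have : 0 < ‖τ • t‖ := norm_pos_iff.2 (smul_ne_zero hτ.ne' ht)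
    unfold radialProfile
    positivity
  have hgpos : ∀ t, g t ≠ 0 := by
    intro t
    simp only [hg]
    split_ifs with h
    · exact ENNReal.top_ne_zero
    · exact (ENNReal.ofReal_pos.2 (hrad t h)).ne'
  have hgm : Measurable g := by
    refine Measurable.ite (measurableSet_singleton 0) measurable_const ?_
    unfold radialProfile
    fun_prop
  have hgi : ∫⁻ t, g t ≠ ⊤ := by
    have : Nonempty (Fin d) := ⟨⟨0, by omega⟩⟩
    have h1 := (integrable_radialProfile_norm (volume : Measure (EuclideanSpace ℝ (Fin d)))
      hη).comp_smul hτ.ne'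
    rw [finrank_euclideanSpace_fin] at h1
    have h2 : ∫⁻ t, g t =
        ∫⁻ t : EuclideanSpace ℝ (Fin d), ENNReal.ofReal (radialProfile d η ‖τ • t‖) := by
      refine lintegral_congr_ae ?_
      filter_upwards [compl_mem_ae_iff.2 (measure_singleton (0 : EuclideanSpace ℝ (Fin d)))]
        with t ht
      exact if_neg ht
    rw [h2]
    exact h1.lintegral_lt_top.ne
  set T : ℝ := ∏ e, τ ^ (2 * lam d * G.ν e) with hT
  have hT0 : 0 < T := Finset.prod_pos fun e _ => Real.rpow_pos_of_pos hτ _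
  set P : Finset (Fin nV → Fin nV) :=
    {p | ∃ idx : Fin nV → ℕ, ∀ v ∉ G.ext, idx (p v) < idx v} with hP
  have hmeas : ∀ p : Fin nV → Fin nV,
      Measurable fun y : {v : Fin nV // v ∉ G.ext} → EuclideanSpace ℝ (Fin d) =>
        ∏ v ∈ G.extᶜ, g (G.assemble x y v - G.assemble x y (p v)) := fun p =>
    Finset.measurable_prod _ fun v _ => hgm.comp
      ((continuous_assemble x _).sub (continuous_assemble x _)).measurable
  have hle : ∀ y, ENNReal.ofReal (G.integrand x y) ≤ ENNReal.ofReal (T * (K + 1)) *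
      ∑ p ∈ P, ∏ v ∈ G.extᶜ, g (G.assemble x y v - G.assemble x y (p v)) := by
    intro y
    set X := G.assemble x y with hX
    have hXA : ∀ v ∈ G.ext, X v = x v := fun v hv => assemble_of_mem hv x y
    by_cases hinj : Function.Injective X
    · obtain ⟨idx, p, hp, hpb⟩ := hbound (fun v => τ • X v)
        ((smul_right_injective _ hτ.ne').comp hinj)
        (fun u hu v hv huv => by
          rw [dist_smul₀, Real.norm_of_nonneg hτ.le, hXA u hu, hXA v hv]
          exact hsep u hu v hv huv)
        (fun u hu v hv => by
          rw [dist_smul₀, Real.norm_of_nonneg hτ.le, hXA u hu, hXA v hv]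
          exact hdiam u v)
      have hpP : p ∈ P := Finset.mem_filter.2 ⟨Finset.mem_univ _, idx, hp⟩
      have hnonneg : ∀ v ∈ G.extᶜ, X v - X (p v) ≠ 0 := by
        intro v hv h
        have h1 := hinj (sub_eq_zero.1 h)
        have h2 := hp v (by simpa using hv)
        rw [← h1] at h2
        exact lt_irrefl _ h2
      have hprod : ∏ v ∈ G.extᶜ, g (X v - X (p v)) = ENNReal.ofReal
          (∏ v ∈ G.extᶜ, radialProfile d η (dist (τ • X v) (τ • X (p v)))) := by
        rw [ENNReal.ofReal_prod_of_nonneg]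
        · refine Finset.prod_congr rfl fun v hv => ?_
          simp only [hg, if_neg (hnonneg v hv), dist_eq_norm, smul_sub]
        · intro v hv
          rw [dist_eq_norm, ← smul_sub]
          exact (hrad _ (hnonneg v hv)).le
      have hint : G.integrand x y =
          T * ∏ e, dist (τ • X (G.ends e).1) (τ • X (G.ends e).2) ^ (-(2 * lam d * G.ν e)) := by
        rw [integrand, hT, ← Finset.prod_mul_distrib]
        refine Finset.prod_congr rfl fun e _ => ?_
        rw [dist_smul₀, Real.norm_of_nonneg hτ.le, Real.mul_rpow hτ.le dist_nonneg, ← mul_assoc,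
          ← Real.rpow_add hτ, add_neg_cancel, Real.rpow_zero, one_mul, dist_eq_norm]
      have hprod0 : 0 ≤ ∏ v ∈ G.extᶜ, radialProfile d η (dist (τ • X v) (τ • X (p v))) := by
        refine Finset.prod_nonneg fun v hv => ?_
        rw [dist_eq_norm, ← smul_sub]
        exact (hrad _ (hnonneg v hv)).le
      calc ENNReal.ofReal (G.integrand x y)
          ≤ ENNReal.ofReal (T * (K + 1) *
              ∏ v ∈ G.extᶜ, radialProfile d η (dist (τ • X v) (τ • X (p v)))) := by
            refine ENNReal.ofReal_le_ofReal ?_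
            rw [hint, mul_assoc]
            refine mul_le_mul_of_nonneg_left (hpb.trans ?_) hT0.le
            exact mul_le_mul_of_nonneg_right (by linarith) hprod0
        _ = ENNReal.ofReal (T * (K + 1)) * ∏ v ∈ G.extᶜ, g (X v - X (p v)) := by
            rw [ENNReal.ofReal_mul (by positivity), hprod]
        _ ≤ _ := by
            gcongr
            exact Finset.single_le_sum
              (f := fun p : Fin nV → Fin nV => ∏ v ∈ G.extᶜ, g (X v - X (p v)))
              (fun _ _ => zero_le) hpP
    · obtain ⟨u, v, huv, hne, hv⟩ : ∃ u v, X u = X v ∧ u ≠ v ∧ v ∉ G.ext := by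
        simp only [Function.Injective, not_forall] at hinj
        obtain ⟨u, v, huv, hne⟩ := hinj
        by_cases hv : v ∈ G.ext
        · refine ⟨v, u, huv.symm, Ne.symm hne, fun hu => hne (hx hu hv ?_)⟩
          rwa [hXA u hu, hXA v hv] at huv
        · exact ⟨u, v, huv, hne, hv⟩
      obtain ⟨a, ha⟩ := hA
      set p : Fin nV → Fin nV := fun w => if w = v then u else a with hp
      have hpP : p ∈ P := by
        refine Finset.mem_filter.2 ⟨Finset.mem_univ _,
          fun w => if w = v then 2 else if w ∈ G.ext then 0 else 1, fun w hw => ?_⟩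
        have hav : a ≠ v := by
          rintro rfl
          exact hv ha
        by_cases hwv : w = v
        · simp only [hp, hwv, if_true, if_neg hne]
          split_ifs <;> norm_num
        · simp [hp, hwv, hw, ha, hav]
      have htop : ∏ w ∈ G.extᶜ, g (X w - X (p w)) = ⊤ := by
        rw [← Finset.mul_prod_erase _ _ (Finset.mem_compl.2 hv)]
        have : g (X v - X (p v)) = ⊤ := by simp [hg, hp, huv]
        rw [this, ENNReal.top_mul (Finset.prod_ne_zero_iff.2 fun w _ => hgpos _)]
      have hsum : ∑ p ∈ P, ∏ v ∈ G.extᶜ, g (X v - X (p v)) = ⊤ := by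
        refine top_le_iff.1 (htop.symm.le.trans ?_)
        exact Finset.single_le_sum
              (f := fun p : Fin nV → Fin nV => ∏ v ∈ G.extᶜ, g (X v - X (p v)))
              (fun _ _ => zero_le) hpP
      rw [hsum, ENNReal.mul_top (ENNReal.ofReal_pos.2 (by positivity)).ne']
      exact le_top
  refine ne_top_of_le_ne_top ?_ (lintegral_mono hle)
  rw [lintegral_const_mul _ (Finset.measurable_sum _ fun p _ => hmeas p),
    lintegral_finsetSum _ fun p _ => hmeas p]
  refine ENNReal.mul_ne_top ENNReal.ofReal_ne_top (ENNReal.sum_ne_top.2 fun p hp => ?_)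
  obtain ⟨idx, hidx⟩ := (Finset.mem_filter.1 hp).2
  exact lintegral_prod_assemble_lt_top x hgm hgi hidx

end FeynmanGraph

/-- The map `h ↦ (1 + h) ^ b` on continuous functions is analytic near `0`. -/
theorem ContinuousMap.exists_analyticAt_one_add_rpow {K : Type*} [TopologicalSpace K]
    [CompactSpace K] (b : ℝ) :
    ∃ P : C(K, ℝ) → C(K, ℝ), AnalyticAt ℝ P 0 ∧
      ∀ᶠ h in nhds (0 : C(K, ℝ)), ∀ c, P h c = (1 + h c) ^ b := by
  set q := binomialSeries C(K, ℝ) b with hq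
  have hreal := Real.one_add_rpow_hasFPowerSeriesOnBall_zero (a := b)
  have hradius : ((1 / 2 : NNReal) : ℝ≥0∞) ≤ q.radius := by
    obtain ⟨C, -, hC⟩ := (binomialSeries ℝ b).norm_mul_pow_le_of_lt_radius (r := 1 / 2)
      (lt_of_lt_of_le (by norm_num) hreal.r_le)
    refine q.le_radius_of_eventually_le C ?_
    filter_upwards [Filter.eventually_gt_atTop 0] with n hn
    refine le_trans ?_ (hC n)
    gcongr
    exact (FormalMultilinearSeries.ofScalars_norm_le _ _ _ hn).trans
      (FormalMultilinearSeries.ofScalars_norm ℝ (fun n => Ring.choose b n) n).ge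
  have hpos : 0 < q.radius := lt_of_lt_of_le (by norm_num) hradius
  have hP := q.hasFPowerSeriesOnBall hpos
  refine ⟨q.sum, hP.analyticAt, ?_⟩
  filter_upwards [Metric.eball_mem_nhds (0 : C(K, ℝ)) hpos,
    Metric.ball_mem_nhds (0 : C(K, ℝ)) one_pos] with h hh hh1 c
  have h1 := hP.hasSum hh
  have h2 : HasSum (fun n => (q n fun _ => h) c) (q.sum h c) := by
    have := h1.mapL (ContinuousMap.evalCLM ℝ c)
    simpa using this
  have h3 : h c ∈ Metric.eball (0 : ℝ) 1 := by
    have : ‖h c‖ < 1 := (h.norm_coe_le_norm c).trans_lt (by simpa using hh1)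
    simpa [enorm_eq_nnnorm, ← NNReal.coe_lt_coe] using this
  have h4 := hreal.hasSum h3
  rw [zero_add] at h4
  refine h2.unique (h4.congr_fun fun n => ?_)
  rw [hq, binomialSeries_apply, binomialSeries_apply]
  simp

theorem pi_withDensity_eq_withDensity_prod {ι E : Type*} [Fintype ι] [MeasureSpace E]
    [SigmaFinite (volume : Measure E)] [AddGroup E] [MeasurableSub₂ E] [MeasurableAdd E]
    [(volume : Measure E).IsAddRightInvariant] {J : E → ℝ≥0∞} (hJ : Measurable J)
    [SigmaFinite ((volume : Measure E).withDensity J)] :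
    Measure.pi (fun _ : ι => (volume : Measure E).withDensity J) =
      (volume : Measure (ι → E)).withDensity fun y => ∏ i, J (y i) := by
  refine Measure.pi_eq fun s hs => ?_
  have hind : ∀ y : ι → E, (Set.univ.pi s).indicator (fun y => ∏ i, J (y i)) y =
      ∏ i, (s i).indicator J (y i - 0) := by
    intro y
    simp only [sub_zero]
    by_cases hy : y ∈ Set.univ.pi s
    · rw [Set.indicator_of_mem hy]
      exact Finset.prod_congr rfl fun i _ => (Set.indicator_of_mem (hy i trivial) J).symm
    · rw [Set.indicator_of_notMem hy]
      obtain ⟨i, hi⟩ : ∃ i, y i ∉ s i := by simpa using hy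
      exact (Finset.prod_eq_zero (Finset.mem_univ i) (Set.indicator_of_notMem hi J)).symm
  rw [withDensity_apply _ (MeasurableSet.univ_pi hs), ← lintegral_indicator
    (MeasurableSet.univ_pi hs)]
  simp_rw [hind]
  rw [lintegral_prod_forest (fun i => hJ.indicator (hs i)) (c := fun _ _ => 0)
    (fun _ => measurable_const) (fun _ => 0) (fun _ _ _ _ _ => rfl)]
  refine Finset.prod_congr rfl fun i _ => ?_
  rw [lintegral_indicator (hs i), withDensity_apply _ (hs i)]

/-- The shift by `w`, localized by the cutoff `χ`. -/
def cutoffShift {E : Type*} [NormedAddCommGroup E] [NormedSpace ℝ E] (χ : E → ℝ) (w y : E) : E :=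
  y + χ y • w

section cutoffShift

variable {E : Type*} [NormedAddCommGroup E] [NormedSpace ℝ E]
  {χ : E → ℝ} {C : NNReal} {w : E}

theorem det_id_add_smulRight [FiniteDimensional ℝ E] (f : E →L[ℝ] ℝ) (w : E) :
    (ContinuousLinearMap.id ℝ E + f.smulRight w).det = 1 + f w := by
  rw [← ContinuousLinearMap.coe_coe f, ← LinearMap.transvection.det]
  exact congrArg LinearMap.det (LinearMap.ext fun _ => rfl)

theorem bijective_cutoffShift [CompleteSpace E] (hχ : LipschitzWith C χ) (hw : C * ‖w‖₊ < 1) :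
    Function.Bijective (cutoffShift χ w) := by
  have h : ApproximatesLinearOn (cutoffShift χ w)
      (ContinuousLinearEquiv.refl ℝ E : E →L[ℝ] E) Set.univ (C * ‖w‖₊) := by
    intro a _ b _
    have h1 : cutoffShift χ w a - cutoffShift χ w b -
        (ContinuousLinearEquiv.refl ℝ E : E →L[ℝ] E) (a - b) = (χ a - χ b) • w := by
      simp only [cutoffShift, ContinuousLinearEquiv.coe_refl, ContinuousLinearMap.coe_id', id]
      module
    rw [h1, norm_smul, NNReal.coe_mul, coe_nnnorm, mul_right_comm]
    gcongr
    exact hχ.norm_sub_le a b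
  have hc : Subsingleton E ∨ C * ‖w‖₊ <
      ‖((ContinuousLinearEquiv.refl ℝ E).symm : E →L[ℝ] E)‖₊⁻¹ := by
    rcases subsingleton_or_nontrivial E with h | h
    · exact Or.inl h
    · right
      simpa using hw
  exact ⟨Set.injOn_univ.1 (h.injOn hc), h.surjective hc⟩

theorem abs_fderiv_apply_le (hχ : LipschitzWith C χ) (y w : E) :
    |fderiv ℝ χ y w| ≤ C * ‖w‖ :=
  (ContinuousLinearMap.le_opNorm _ _).trans
    (mul_le_mul_of_nonneg_right (norm_fderiv_le_of_lipschitz ℝ hχ) (norm_nonneg _))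

theorem map_cutoffShift [FiniteDimensional ℝ E] [MeasurableSpace E] [BorelSpace E]
    (μ : Measure E) [μ.IsAddHaarMeasure] (hdiff : ContDiff ℝ 1 χ)
    (hχ : LipschitzWith C χ) (hw : C * ‖w‖₊ < 1) :
    (μ.withDensity fun y => ENNReal.ofReal (1 + fderiv ℝ χ y w)).map (cutoffShift χ w) = μ := by
  have : CompleteSpace E := FiniteDimensional.complete ℝ E
  obtain ⟨hinj, hsurj⟩ := bijective_cutoffShift hχ hw
  have hderiv : ∀ y, HasFDerivAt (cutoffShift χ w)
      (ContinuousLinearMap.id ℝ E + (fderiv ℝ χ y).smulRight w) y := fun y =>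
    (hasFDerivAt_id y).add
      (((hdiff.differentiable one_ne_zero) y).hasFDerivAt.smul_const w)
  have h := map_withDensity_abs_det_fderiv_eq_addHaar μ (s := Set.univ) (by simp)
    (fun y _ => (hderiv y).hasFDerivWithinAt) hinj.injOn
  rw [Set.image_univ, hsurj.range_eq, Measure.restrict_univ] at h
  convert h using 4 with y
  rw [det_id_add_smulRight, abs_of_nonneg]
  have h1 := abs_fderiv_apply_le hχ y w
  have h2 : (C : ℝ) * ‖w‖ < 1 := by exact_mod_cast hw
  linarith [neg_le_of_abs_le h1]

theorem lintegral_pi_cutoffShift {ι : Type*} [Fintype ι] [FiniteDimensional ℝ E] [MeasureSpace E]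
    [BorelSpace E] [(volume : Measure E).IsAddHaarMeasure] (hdiff : ContDiff ℝ 1 χ)
    (hχ : LipschitzWith C χ) (hw : C * ‖w‖₊ < 1) {F : (ι → E) → ℝ≥0∞} (hF : Measurable F) :
    ∫⁻ y, F y = ∫⁻ y : ι → E, (∏ i, ENNReal.ofReal (1 + fderiv ℝ χ (y i) w)) *
      F fun i => cutoffShift χ w (y i) := by
  have hcont : Continuous fun y => fderiv ℝ χ y w :=
    (hdiff.continuous_fderiv one_ne_zero).clm_apply continuous_const
  have hJ : Measurable fun y => ENNReal.ofReal (1 + fderiv ℝ χ y w) := by fun_prop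
  have hshift : Measurable (cutoffShift χ w) := by
    have := hχ.continuous
    unfold cutoffShift
    exact Continuous.measurable (by fun_prop)
  have hsf : SigmaFinite ((volume : Measure E).withDensity
      fun y => ENNReal.ofReal (1 + fderiv ℝ χ y w)) :=
    SigmaFinite.withDensity_ofReal _
  have hsf' : SigmaFinite (((volume : Measure E).withDensity
      fun y => ENNReal.ofReal (1 + fderiv ℝ χ y w)).map (cutoffShift χ w)) := by
    rw [map_cutoffShift volume hdiff hχ hw]
    infer_instance
  have h := Measure.pi_map_pi (μ := fun _ : ι => (volume : Measure E).withDensity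
    fun y => ENNReal.ofReal (1 + fderiv ℝ χ y w)) (f := fun _ => cutoffShift χ w)
    (fun _ => hshift.aemeasurable)
  rw [map_cutoffShift volume hdiff hχ hw, pi_withDensity_eq_withDensity_prod hJ, ← volume_pi] at h
  nth_rw 1 [← h]
  rw [lintegral_map hF (by fun_prop), lintegral_withDensity_eq_lintegral_mul]
  · rfl
  · fun_prop
  · fun_prop

end cutoffShift

/-- The family of functions `c ↦ ⟪q c, w⟫`, linear in `w`. -/
def ContinuousMap.innerMap {K E : Type*} [TopologicalSpace K] [CompactSpace K]
    [NormedAddCommGroup E] [InnerProductSpace ℝ E] [FiniteDimensional ℝ E] (q : C(K, E)) :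
    E →L[ℝ] C(K, ℝ) :=
  LinearMap.toContinuousLinearMap
    { toFun := fun w => ⟨fun c => inner ℝ (q c) w, by fun_prop⟩
      map_add' := fun w w' => by ext c; simp [inner_add_right]
      map_smul' := fun t w => by ext c; simp [inner_smul_right] }

/-- Integration along a measurable map to a compact space. -/
theorem exists_integral_comp_clm {Y K : Type*} [MeasurableSpace Y] (μ : Measure Y)
    [IsFiniteMeasure μ] [TopologicalSpace K] [CompactSpace K] [MeasurableSpace K] [BorelSpace K]
    {c : Y → K} (hc : Measurable c) :
    ∃ L : C(K, ℝ) →L[ℝ] ℝ, ∀ f, L f = ∫ y, f (c y) ∂μ := by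
  have hint : ∀ f : C(K, ℝ), Integrable (fun y => f (c y)) μ := fun f =>
    Integrable.of_bound (f.continuous.measurable.comp hc).aestronglyMeasurable ‖f‖
      (Filter.Eventually.of_forall fun y => f.norm_coe_le_norm _)
  refine ⟨LinearMap.mkContinuous
    { toFun := fun f => ∫ y, f (c y) ∂μ
      map_add' := fun f g => integral_add (hint f) (hint g)
      map_smul' := fun t f => integral_const_mul t _ } (μ.real Set.univ) fun f => ?_, fun f => rfl⟩
  refine (norm_integral_le_of_norm_le_const
    (Filter.Eventually.of_forall fun y => f.norm_coe_le_norm (c y))).trans ?_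
  rw [mul_comm]

theorem analyticAt_integral_prod_rpow {Y E ε ι : Type*} [MeasurableSpace Y] (μ : Measure Y)
    [IsFiniteMeasure μ] [NormedAddCommGroup E] [InnerProductSpace ℝ E] [FiniteDimensional ℝ E]
    [MeasurableSpace E] [BorelSpace E] [Fintype ε] [Fintype ι]
    {q : ε → Y → E} {r : ε → Y → ℝ} {g : ι → Y → E} (hq : ∀ e, Measurable (q e))
    (hr : ∀ e, Measurable (r e)) (hg : ∀ i, Measurable (g i)) {R : ℝ} (hR : 0 ≤ R)
    (hqR : ∀ e y, ‖q e y‖ ≤ R) (hrR : ∀ e y, ‖r e y‖ ≤ R) (hgR : ∀ i y, ‖g i y‖ ≤ R)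
    (b : ε → ℝ) :
    AnalyticAt ℝ (fun w : E => ∫ y,
      (∏ e, (1 + (2 * inner ℝ (q e y) w + ‖w‖ ^ 2 * r e y ^ 2)) ^ b e) *
        ∏ i, (1 + inner ℝ (g i y) w) ∂μ) 0 := by
  have hproper : ProperSpace E := FiniteDimensional.proper ℝ E
  have hK : CompactSpace (Metric.closedBall (0 : (ε → E × ℝ) × (ι → E)) R) :=
    isCompact_iff_compactSpace.1 (isCompact_closedBall _ _)
  set K := Metric.closedBall (0 : (ε → E × ℝ) × (ι → E)) R with hKdef
  have hmem : ∀ y, ((fun e => (q e y, r e y), fun i => g i y) : (ε → E × ℝ) × (ι → E)) ∈ K := by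
    intro y
    rw [hKdef, mem_closedBall_zero_iff, Prod.norm_def, sup_le_iff]
    refine ⟨(pi_norm_le_iff_of_nonneg hR).2 fun e => ?_, (pi_norm_le_iff_of_nonneg hR).2 (hgR · y)⟩
    rw [Prod.norm_def]
    exact sup_le (hqR e y) (hrR e y)
  have hc : Measurable fun y => (⟨_, hmem y⟩ : K) := by
    refine Measurable.subtype_mk (Measurable.prodMk ?_ ?_)
    · exact measurable_pi_lambda _ fun e => (hq e).prodMk (hr e)
    · exact measurable_pi_lambda _ hg
  obtain ⟨L, hL⟩ := exists_integral_comp_clm μ hc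
  choose P hP hPev using fun e => ContinuousMap.exists_analyticAt_one_add_rpow (K := K) (b e)
  let Q : ε → C(K, E) := fun e => ⟨fun c => (c.1.1 e).1, by fun_prop⟩
  let S : ε → C(K, ℝ) := fun e => ⟨fun c => (c.1.1 e).2, by fun_prop⟩
  let D : ι → C(K, E) := fun i => ⟨fun c => c.1.2 i, by fun_prop⟩
  let h : ε → E → C(K, ℝ) := fun e w => (2 : ℝ) • (Q e).innerMap w + ‖w‖ ^ 2 • S e ^ 2
  have hh0 : ∀ e, h e 0 = 0 := fun e => by simp [h]
  have hnorm : AnalyticAt ℝ (fun w : E => ‖w‖ ^ 2) 0 :=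
    (contDiff_norm_sq ℝ).contDiffAt.analyticAt
  have hh : ∀ e, AnalyticAt ℝ (h e) 0 := fun e =>
    (analyticAt_const.fun_smul ((Q e).innerMap.analyticAt 0)).fun_add
      (hnorm.fun_smul analyticAt_const)
  have hΨ : AnalyticAt ℝ (fun w => (∏ e, P e (h e w)) * ∏ i, (1 + (D i).innerMap w)) 0 := by
    refine AnalyticAt.mul ?_ ?_
    · refine Finset.analyticAt_fun_prod _ fun e _ => ?_
      exact AnalyticAt.comp (by rw [hh0]; exact hP e) (hh e)
    · exact Finset.analyticAt_fun_prod _ fun i _ =>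
        analyticAt_const.add ((D i).innerMap.analyticAt 0)
  refine ((L.analyticAt _).comp hΨ).congr ?_
  have hev : ∀ᶠ w in nhds (0 : E), ∀ e c, P e (h e w) c = (1 + h e w c) ^ b e := by
    refine Filter.eventually_all.2 fun e => ?_
    have := (hh e).continuousAt.tendsto
    rw [hh0] at this
    exact this.eventually (hPev e)
  filter_upwards [hev] with w hw
  rw [Function.comp_apply, hL]
  refine integral_congr_ae (Filter.Eventually.of_forall fun y => ?_)
  simp only [ContinuousMap.mul_apply, ContinuousMap.prod_apply, hw]
  rfl

theorem norm_cutoffShift_sub_rpow {E : Type*} [NormedAddCommGroup E] [InnerProductSpace ℝ E]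
    (χ : E → ℝ) (w x y : E) (a : ℝ) :
    0 ≤ 1 + (2 * inner ℝ (((χ x - χ y) / ‖x - y‖ ^ 2) • (x - y)) w +
        ‖w‖ ^ 2 * ((χ x - χ y) / ‖x - y‖) ^ 2) ∧
    ‖cutoffShift χ w x - cutoffShift χ w y‖ ^ (-(2 * a)) = ‖x - y‖ ^ (-(2 * a)) *
      (1 + (2 * inner ℝ (((χ x - χ y) / ‖x - y‖ ^ 2) • (x - y)) w +
        ‖w‖ ^ 2 * ((χ x - χ y) / ‖x - y‖) ^ 2)) ^ (-a) := by
  rcases eq_or_ne x y with rfl | hne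
  · simp
  have hpos : 0 < ‖x - y‖ := norm_sub_pos_iff.2 hne
  have hsub : cutoffShift χ w x - cutoffShift χ w y = (x - y) + (χ x - χ y) • w := by
    simp only [cutoffShift]
    module
  have hsq : 1 + (2 * inner ℝ (((χ x - χ y) / ‖x - y‖ ^ 2) • (x - y)) w +
      ‖w‖ ^ 2 * ((χ x - χ y) / ‖x - y‖) ^ 2) =
      (‖cutoffShift χ w x - cutoffShift χ w y‖ / ‖x - y‖) ^ 2 := by
    rw [hsub, div_pow, div_pow, norm_add_sq_real, real_inner_smul_left, real_inner_smul_right, norm_smul,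
      mul_pow, Real.norm_eq_abs, sq_abs]
    field_simp
    ring
  rw [hsq]
  refine ⟨by positivity, ?_⟩
  rw [← Real.rpow_natCast, ← Real.rpow_mul (by positivity), Real.div_rpow (by positivity) hpos.le]
  have h2 : ((2 : ℕ) : ℝ) * -a = -(2 * a) := by push_cast; ring
  rw [h2, mul_div_cancel₀]
  exact (Real.rpow_pos_of_pos hpos _).ne'

theorem norm_div_norm_sub_le {E : Type*} [NormedAddCommGroup E] {χ : E → ℝ} {C : NNReal}
    (hχ : LipschitzWith C χ) (x y : E) : ‖(χ x - χ y) / ‖x - y‖‖ ≤ C := by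
  rw [norm_div, norm_norm]
  exact div_le_of_le_mul₀ (norm_nonneg _) C.2 (hχ.norm_sub_le x y)

theorem exists_cutoff {E : Type*} [NormedAddCommGroup E] [InnerProductSpace ℝ E]
    [FiniteDimensional ℝ E] (p : E) (s : Set E) (hs : s.Finite) (hp : p ∉ s) :
    ∃ (χ : E → ℝ) (C : NNReal), ContDiff ℝ 1 χ ∧ LipschitzWith C χ ∧ χ p = 1 ∧
      ∀ x ∈ s, χ x = 0 := by
  obtain ⟨r, hr, hball⟩ := Metric.mem_nhds_iff.1 (hs.isClosed.isOpen_compl.mem_nhds hp)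
  let f : ContDiffBump p := ⟨r / 2, r, by positivity, by linarith⟩
  obtain ⟨C, hC⟩ := (f.contDiff (n := 1)).lipschitzWith_of_hasCompactSupport
    f.hasCompactSupport one_ne_zero
  refine ⟨f, C, f.contDiff, hC, f.one_of_mem_closedBall (Metric.mem_closedBall_self f.rIn_pos.le),
    fun x hx => f.zero_of_le_dist ?_⟩
  by_contra! h
  exact hball (Metric.mem_ball.2 h) hx

namespace FeynmanGraph

variable {d nV nE : ℕ} {G : FeynmanGraph nV nE}

theorem assemble_comp {E : Type*} (φ : E → E) (x : Fin nV → E)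
    (y : {v : Fin nV // v ∉ G.ext} → E) (v : Fin nV) :
    G.assemble (fun v => φ (x v)) (fun i => φ (y i)) v = φ (G.assemble x y v) := by
  unfold assemble
  split_ifs <;> rfl

theorem measurable_integrand (x : Fin nV → EuclideanSpace ℝ (Fin d)) :
    Measurable (G.integrand x) := by
  refine Finset.measurable_fun_prod _ fun e _ => ?_
  exact ((continuous_assemble x _).sub (continuous_assemble x _)).measurable.norm.pow_const _

theorem integrand_nonneg (x : Fin nV → EuclideanSpace ℝ (Fin d))
    (y : {v : Fin nV // v ∉ G.ext} → EuclideanSpace ℝ (Fin d)) : 0 ≤ G.integrand x y :=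
  Finset.prod_nonneg fun _ _ => by positivity

theorem integrand_congr {x x' : Fin nV → EuclideanSpace ℝ (Fin d)}
    (h : ∀ v ∈ G.ext, x v = x' v) : G.integrand x = G.integrand x' := by
  have : ∀ y v, G.assemble x y v = G.assemble x' y v := by
    intro y v
    unfold assemble
    split_ifs with hv
    · exact h v hv
    · rfl
  ext y
  simp only [integrand, this]

theorem analyticAt_lintegral_integrand {χ : EuclideanSpace ℝ (Fin d) → ℝ} {C : NNReal}
    (hdiff : ContDiff ℝ 1 χ) (hχ : LipschitzWith C χ) {x : Fin nV → EuclideanSpace ℝ (Fin d)}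
    (hfin : ∫⁻ y, ENNReal.ofReal (G.integrand x y) ≠ ⊤) :
    AnalyticAt ℝ (fun w => (∫⁻ y, ENNReal.ofReal
      (G.integrand (fun v => cutoffShift χ w (x v)) y)).toReal) 0 := by
  set μ : Measure ({v : Fin nV // v ∉ G.ext} → EuclideanSpace ℝ (Fin d)) :=
    volume.withDensity fun y => ENNReal.ofReal (G.integrand x y) with hμ
  have : IsFiniteMeasure μ := isFiniteMeasure_withDensity hfin
  let X := fun (v : Fin nV) (y : {v : Fin nV // v ∉ G.ext} → EuclideanSpace ℝ (Fin d)) =>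
    G.assemble x y v
  have hX : ∀ v, Measurable (X v) := fun v => (continuous_assemble x v).measurable
  have hχm : Measurable χ := hdiff.continuous.measurable
  let q := fun e y => ((χ (X (G.ends e).1 y) - χ (X (G.ends e).2 y)) /
    ‖X (G.ends e).1 y - X (G.ends e).2 y‖ ^ 2) • (X (G.ends e).1 y - X (G.ends e).2 y)
  let r := fun e y => (χ (X (G.ends e).1 y) - χ (X (G.ends e).2 y)) /
    ‖X (G.ends e).1 y - X (G.ends e).2 y‖
  let g := fun (i : {v : Fin nV // v ∉ G.ext})
      (y : {v : Fin nV // v ∉ G.ext} → EuclideanSpace ℝ (Fin d)) =>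
    (InnerProductSpace.toDual ℝ _).symm (fderiv ℝ χ (y i))
  have hq : ∀ e, Measurable (q e) := fun e => by
    have h1 := hX (G.ends e).1
    have h2 := hX (G.ends e).2
    fun_prop
  have hr : ∀ e, Measurable (r e) := fun e => by
    have h1 := hX (G.ends e).1
    have h2 := hX (G.ends e).2
    fun_prop
  have hg : ∀ i, Measurable (g i) := fun i =>
    ((InnerProductSpace.toDual ℝ _).symm.continuous.comp
      ((hdiff.continuous_fderiv one_ne_zero).comp (continuous_apply i))).measurable
  have hrR : ∀ e y, ‖r e y‖ ≤ C := fun e y => norm_div_norm_sub_le hχ _ _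
  have hqR : ∀ e y, ‖q e y‖ ≤ C := by
    intro e y
    refine le_trans (le_of_eq ?_) (hrR e y)
    simp only [q, r, norm_smul, norm_div, norm_pow, norm_norm]
    rcases eq_or_ne ‖X (G.ends e).1 y - X (G.ends e).2 y‖ 0 with h | h
    · simp [h]
    · field_simp
  have hgR : ∀ i y, ‖g i y‖ ≤ C := by
    intro i y
    simp only [g, LinearIsometryEquiv.norm_map]
    exact norm_fderiv_le_of_lipschitz ℝ hχ
  refine (analyticAt_integral_prod_rpow μ hq hr hg C.2 hqR hrR hgR
    (fun e => -(lam d * G.ν e))).congr ?_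
  have hsmall : ∀ᶠ w : EuclideanSpace ℝ (Fin d) in nhds 0, C * ‖w‖₊ < 1 := by
    have : Continuous fun w : EuclideanSpace ℝ (Fin d) => C * ‖w‖₊ := by fun_prop
    exact (this.tendsto 0).eventually_lt_const (by simp)
  filter_upwards [hsmall] with w hw
  have hjac : ∀ i y, 0 ≤ 1 + inner ℝ (g i y) w := by
    intro i y
    have h1 := abs_fderiv_apply_le hχ (y i) w
    have h2 : (C : ℝ) * ‖w‖ < 1 := by exact_mod_cast hw
    simp only [g, InnerProductSpace.toDual_symm_apply]
    linarith [neg_le_of_abs_le h1]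
  have hfac : ∀ e y, 0 ≤ 1 + (2 * inner ℝ (q e y) w + ‖w‖ ^ 2 * r e y ^ 2) := fun e y =>
    (norm_cutoffShift_sub_rpow χ w _ _ 0).1
  have hprod1 : ∀ y, 0 ≤ ∏ e, (1 + (2 * inner ℝ (q e y) w + ‖w‖ ^ 2 * r e y ^ 2)) ^
      (-(lam d * G.ν e)) := fun y =>
    Finset.prod_nonneg fun e _ => Real.rpow_nonneg (hfac e y) _
  have hprod2 : ∀ y, 0 ≤ ∏ i, (1 + inner ℝ (g i y) w) := fun y =>
    Finset.prod_nonneg fun i _ => hjac i y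
  have hmeas : Measurable fun y =>
      (∏ e, (1 + (2 * inner ℝ (q e y) w + ‖w‖ ^ 2 * r e y ^ 2)) ^ (-(lam d * G.ν e))) *
        ∏ i, (1 + inner ℝ (g i y) w) := by
    fun_prop
  rw [integral_eq_lintegral_of_nonneg_ae
    (Filter.Eventually.of_forall fun y => mul_nonneg (hprod1 y) (hprod2 y))
    hmeas.aestronglyMeasurable,
    hμ, lintegral_withDensity_eq_lintegral_mul _ (measurable_integrand x).ennreal_ofReal
      hmeas.ennreal_ofReal,
    lintegral_pi_cutoffShift hdiff hχ hw (measurable_integrand _).ennreal_ofReal]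
  congr 1
  refine lintegral_congr fun y => ?_
  have hint : G.integrand (fun v => cutoffShift χ w (x v)) (fun i => cutoffShift χ w (y i)) =
      G.integrand x y * ∏ e, (1 + (2 * inner ℝ (q e y) w + ‖w‖ ^ 2 * r e y ^ 2)) ^
        (-(lam d * G.ν e)) := by
    rw [integrand, integrand, ← Finset.prod_mul_distrib]
    refine Finset.prod_congr rfl fun e _ => ?_
    rw [assemble_comp, assemble_comp, mul_assoc]
    exact (norm_cutoffShift_sub_rpow χ w _ _ _).2
  have hdet : ∏ i, ENNReal.ofReal (1 + fderiv ℝ χ (y i) w) =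
      ENNReal.ofReal (∏ i, (1 + inner ℝ (g i y) w)) := by
    rw [ENNReal.ofReal_prod_of_nonneg fun i _ => hjac i y]
    simp only [g, InnerProductSpace.toDual_symm_apply]
  rw [hint, hdet, Pi.mul_apply, ENNReal.ofReal_mul (hprod1 y),
    ENNReal.ofReal_mul (integrand_nonneg x y)]
  ring

/-- The linear embedding of the plane as the first two coordinates. -/
def planeEmbedding (d : ℕ) : ℝ × ℝ →L[ℝ] EuclideanSpace ℝ (Fin d) :=
  (ContinuousLinearMap.fst ℝ ℝ ℝ).smulRight
      (WithLp.toLp 2 fun i : Fin d => if (i : ℕ) = 0 then (1 : ℝ) else 0) +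
    (ContinuousLinearMap.snd ℝ ℝ ℝ).smulRight
      (WithLp.toLp 2 fun i : Fin d => if (i : ℕ) = 1 then (1 : ℝ) else 0)

theorem planeEmbedding_apply (q : ℝ × ℝ) (i : Fin d) :
    planeEmbedding d q i = if (i : ℕ) = 0 then q.1 else if (i : ℕ) = 1 then q.2 else 0 := by
  rcases eq_or_ne (i : ℕ) 0 with h | h
  · simp [planeEmbedding, h]
  · simp [planeEmbedding, h]

theorem planeEmbedding_injective (hd : 2 ≤ d) : Function.Injective (planeEmbedding d) := by
  intro p q h
  have h0 := congrArg (fun x : EuclideanSpace ℝ (Fin d) => x ⟨0, by omega⟩) h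
  have h1 := congrArg (fun x : EuclideanSpace ℝ (Fin d) => x ⟨1, by omega⟩) h
  simp only [planeEmbedding_apply] at h0 h1
  exact Prod.ext (by simpa using h0) (by simpa using h1)

section extPos

variable {v0 v1 vz : Fin nV}

theorem extPos_zero (z : ℂ) : extPos d v0 v1 vz z v0 = planeEmbedding d (0, 0) := by
  ext i
  simp [extPos, planeEmbedding_apply]

theorem extPos_one (h01 : v0 ≠ v1) (z : ℂ) :
    extPos d v0 v1 vz z v1 = planeEmbedding d (1, 0) := by
  ext i
  simp [extPos, planeEmbedding_apply, h01.symm]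

theorem extPos_z (h0z : v0 ≠ vz) (h1z : v1 ≠ vz) (p : ℝ × ℝ) :
    extPos d v0 v1 vz (p.1 + p.2 * Complex.I) vz = planeEmbedding d p := by
  ext i
  simp [extPos, planeEmbedding_apply, h0z.symm, h1z.symm]

end extPos

theorem graphicalFn_eq (v0 v1 vz : Fin nV) (z : ℂ) :
    G.graphicalFn d v0 v1 vz z =
      (∫⁻ y, ENNReal.ofReal (G.integrand (extPos d v0 v1 vz z) y)) /
        ENNReal.ofReal (Real.pi ^ ((d : ℝ) / 2 * (G.intVerts.card : ℝ))) := rfl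

end FeynmanGraph

/-- For an ultraviolet and infrared convergent graph `G` with three
external vertices `0`, `1`, `z`, the graphical function is finite and real analytic on
`ℂ ∖ {0,1}`; i.e. `(a,b) ↦ f_G(a + b·i)` is a finite real-valued, real-analytic
function on `ℝ² ∖ {(0,0), (1,0)}`. -/
theorem graphicalFn_realAnalytic {d nV nE : ℕ} (hd : 2 < d) (G : FeynmanGraph nV nE)
    (v0 v1 vz : Fin nV) (h01 : v0 ≠ v1) (h0z : v0 ≠ vz) (h1z : v1 ≠ vz)
    (hext : G.ext = {v0, v1, vz})
    (hUV : G.UVConvergent d) (hIR : G.IRConvergent d) :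
    ∀ p : ℝ × ℝ, p ≠ (0, 0) → p ≠ (1, 0) →
      G.graphicalFn d v0 v1 vz (p.1 + p.2 * Complex.I) ≠ ⊤ ∧
      AnalyticAt ℝ
        (fun q : ℝ × ℝ => (G.graphicalFn d v0 v1 vz (q.1 + q.2 * Complex.I)).toReal) p := by
  intro p hp0 hp1
  have hinj := FeynmanGraph.planeEmbedding_injective (d := d) hd.le
  set x := FeynmanGraph.extPos d v0 v1 vz (p.1 + p.2 * Complex.I) with hx
  have hx0 : x v0 = FeynmanGraph.planeEmbedding d (0, 0) := FeynmanGraph.extPos_zero _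
  have hx1 : x v1 = FeynmanGraph.planeEmbedding d (1, 0) := FeynmanGraph.extPos_one h01 _
  have hxz : x vz = FeynmanGraph.planeEmbedding d p := FeynmanGraph.extPos_z h0z h1z p
  have hxinj : Set.InjOn x G.ext := by
    have h2 : ((0, 0) : ℝ × ℝ) ≠ (1, 0) := by simp
    intro u hu v hv huv
    simp only [hext, Finset.coe_insert, Finset.coe_singleton, Set.mem_insert_iff,
      Set.mem_singleton_iff] at hu hv
    rcases hu with rfl | rfl | rfl <;> rcases hv with rfl | rfl | rfl <;>
      simp only [hx0, hx1, hxz, hinj.eq_iff] at huv <;> first | rfl | skip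
    exacts [absurd huv h2, absurd huv hp0.symm, absurd huv h2.symm, absurd huv hp1.symm,
      absurd huv hp0, absurd huv hp1]
  have hfin : ∫⁻ y, ENNReal.ofReal (G.integrand x y) ≠ ⊤ :=
    FeynmanGraph.lintegral_integrand_ne_top hd hUV hIR (by simp [hext]) hxinj
  have hpi : ENNReal.ofReal (Real.pi ^ ((d : ℝ) / 2 * (G.intVerts.card : ℝ))) ≠ 0 :=
    (ENNReal.ofReal_pos.2 (Real.rpow_pos_of_pos Real.pi_pos _)).ne'
  refine ⟨ENNReal.div_ne_top hfin hpi, ?_⟩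
  obtain ⟨χ, C, hdiff, hχ, hχz, hχ0⟩ := exists_cutoff (x vz)
    {FeynmanGraph.planeEmbedding d (0, 0), FeynmanGraph.planeEmbedding d (1, 0)}
    (Set.toFinite _) (by
      simp only [Set.mem_insert_iff, Set.mem_singleton_iff, hxz, hinj.eq_iff, not_or]
      exact ⟨hp0, hp1⟩)
  have hshift : ∀ q : ℝ × ℝ, G.integrand (FeynmanGraph.extPos d v0 v1 vz (q.1 + q.2 * Complex.I)) =
      G.integrand fun v => cutoffShift χ (FeynmanGraph.planeEmbedding d (q - p)) (x v) := by
    intro q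
    refine FeynmanGraph.integrand_congr fun v hv => ?_
    rw [hext, Finset.mem_insert, Finset.mem_insert, Finset.mem_singleton] at hv
    rcases hv with rfl | rfl | rfl
    · rw [FeynmanGraph.extPos_zero, hx0, cutoffShift, hχ0 _ (by simp), zero_smul, add_zero]
    · rw [FeynmanGraph.extPos_one h01, hx1, cutoffShift, hχ0 _ (by simp), zero_smul, add_zero]
    · rw [FeynmanGraph.extPos_z h0z h1z, cutoffShift, hχz, one_smul, hxz, map_sub,
        add_sub_cancel]
  simp only [FeynmanGraph.graphicalFn_eq, hshift, ENNReal.toReal_div]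
  refine AnalyticAt.div_const ?_
  have hlin : AnalyticAt ℝ (fun q : ℝ × ℝ => FeynmanGraph.planeEmbedding d (q - p)) p :=
    ((FeynmanGraph.planeEmbedding d).analyticAt _).comp (analyticAt_id.sub analyticAt_const)
  refine AnalyticAt.fun_comp (g := fun w => (∫⁻ y, ENNReal.ofReal
      (G.integrand (fun v => cutoffShift χ w (x v)) y)).toReal) ?_ hlin
  rw [sub_self, map_zero]
  exact FeynmanGraph.analyticAt_lintegral_integrand hdiff hχ hfin
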